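/- arXiv:0907.4459 — 3 statements merged into one kernel-verified Lean document; each statement's English description precedes it below -/
import Mathlib

section
/- Let k ≥ 1, 1 ≤ j ≤ k, ℓ = k − j + 1. Let G be a graph on vertex set J ∪ B with |J| = j, consisting of a clique on J together with a bipartite graph H with parts J and B, such that (i) every v ∈ J has degree at least ℓ in H, and some vertex of J (the apex) has degree at least ℓ+1 in H; and (ii) for every pair of distinct v, v' ∈ J, the set N_H({v,v'}) \ {v,v'} has at least ℓ+1 elements. Then, if k is even, G contains k/2 pairwise edge-disjoint linear forests which together contain all edges of the clique on J, such that every vertex of J has degree exactly 2 in each forest. -/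
namespace LF
open Classical

noncomputable def dg {V : Type*} (F : SimpleGraph V) (v : V) : ℕ := (F.neighborSet v).ncard

theorem rank_acyclic {V : Type*} (F : SimpleGraph V) (rk : V → ℕ)
    (hne : ∀ v w, F.Adj v w → rk v ≠ rk w)
    (huniq : ∀ v a b, F.Adj v a → F.Adj v b → rk a < rk v → rk b < rk v → a = b) :
    F.IsAcyclic := by
  intro v c hc
  obtain ⟨w, hw, hmax⟩ : ∃ w ∈ c.support.toFinset, ∀ x ∈ c.support.toFinset, rk x ≤ rk w :=
    Finset.exists_max_image _ _ ⟨v, by simp⟩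
  have hw' : w ∈ c.support := by simpa using hw
  have hc' := hc.rotate hw'
  have hsupp : ∀ x ∈ (c.rotate w hw').support, x ∈ c.support := by
    intro x hx
    simpa using hx
  have hn : ¬ (c.rotate w hw').Nil := hc'.not_nil
  have h1 := SimpleGraph.Walk.adj_snd hn
  have h2 := (SimpleGraph.Walk.adj_penultimate hn).symm
  have h3 := hc'.snd_ne_penultimate
  have m1 : rk (c.rotate w hw').snd ≤ rk w := hmax _ (by
    have := hsupp _ (List.mem_of_mem_tail (SimpleGraph.Walk.snd_mem_tail_support hn))
    simpa using this)
  have m2 : rk (c.rotate w hw').penultimate ≤ rk w := hmax _ (by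
    have := hsupp _ (List.mem_of_mem_dropLast (SimpleGraph.Walk.penultimate_mem_dropLast_support hn))
    simpa using this)
  exact h3 (huniq _ _ _ h1 h2 (lt_of_le_of_ne m1 (hne _ _ h1).symm)
    (lt_of_le_of_ne m2 (hne _ _ h2).symm))

theorem weight_le {V : Type*} [Fintype V] (F : SimpleGraph V) (hF : F.IsAcyclic) (hd : ∀ v, dg F v ≤ 2)
    (v : V) (S : Finset V) (hS : ∀ x ∈ S, F.Reachable v x) :
    ∑ x ∈ S, (2 - dg F x) ≤ 2 := by
  let c := F.connectedComponentMk v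
  have ht := hF.isTree_connectedComponent c
  have h1 := ht.card_edgeFinset
  have h2 := c.toSimpleGraph.sum_degrees_eq_twice_card_edges
  have h3 : ∀ x : c, c.toSimpleGraph.degree x = dg F x := by
    intro x
    rw [dg, ← SimpleGraph.card_neighborSet_eq_degree, ← Nat.card_eq_fintype_card, ← Nat.card_coe_set_eq]
    apply Nat.card_congr
    have hx : x.1 ∈ c.supp := x.2
    exact ⟨fun y => ⟨y.1.1, y.2⟩,
      fun y => ⟨⟨y.1, c.mem_supp_of_adj_mem_supp hx y.2⟩, y.2⟩, fun y => rfl, fun y => rfl⟩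
  have h4 : ∑ x : c, (2 - dg F x) + ∑ x : c, dg F x = 2 * Fintype.card c := by
    rw [← Finset.sum_add_distrib, Finset.sum_congr rfl (g := fun _ => 2)]
    · simp [mul_comm]
    · intro x _
      have := hd x
      omega
  have h5 : ∑ x : c, (2 - dg F x) = 2 := by
    simp only [h3] at h2
    have : 0 < Fintype.card c := Fintype.card_pos_iff.mpr ⟨⟨v, rfl⟩⟩
    omega
  have h6 : ∑ x : c, (2 - dg F x) = ∑ x ∈ Finset.univ.filter (fun x => x ∈ c), (2 - dg F x) := by
    rw [Finset.sum_subtype (p := fun x => x ∈ c)] 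
    simp
  refine le_trans ?_ (le_of_eq (h6.symm.trans h5))
  apply Finset.sum_le_sum_of_subset
  intro x hx
  have := hS x hx
  simp only [Finset.mem_filter, Finset.mem_univ, true_and]
  exact SimpleGraph.ConnectedComponent.sound this.symm

theorem add_adj {V : Type*} (F : SimpleGraph V) {u b : V} (hub : u ≠ b) (x y : V) :
    (F ⊔ SimpleGraph.edge u b).Adj x y ↔ F.Adj x y ∨ (x = u ∧ y = b) ∨ (x = b ∧ y = u) := by
  rw [SimpleGraph.sup_adj, SimpleGraph.edge_adj]
  constructor
  · tauto
  · rintro (h | ⟨rfl, rfl⟩ | ⟨rfl, rfl⟩)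
    · exact Or.inl h
    · exact Or.inr ⟨by simp, hub⟩
    · exact Or.inr ⟨by simp, hub.symm⟩

theorem dg_add {V : Type*} [Fintype V] (F : SimpleGraph V) {u b : V} (hub : u ≠ b) (hn : ¬ F.Adj u b) (x : V) :
    dg (F ⊔ SimpleGraph.edge u b) x = dg F x + if x = u ∨ x = b then 1 else 0 := by
  unfold dg
  by_cases h1 : x = u
  · subst h1
    have : (F ⊔ SimpleGraph.edge x b).neighborSet x = insert b (F.neighborSet x) := by
      ext y
      simp only [SimpleGraph.mem_neighborSet, add_adj F hub, Set.mem_insert_iff]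
      grind
    rw [this, Set.ncard_insert_of_notMem (by simpa using hn) (Set.toFinite _)]
    simp
  · by_cases h2 : x = b
    · subst h2
      have : (F ⊔ SimpleGraph.edge u x).neighborSet x = insert u (F.neighborSet x) := by
        ext y
        simp only [SimpleGraph.mem_neighborSet, add_adj F hub, Set.mem_insert_iff]
        grind
      rw [this, Set.ncard_insert_of_notMem (by simpa [SimpleGraph.adj_comm] using hn) (Set.toFinite _)]
      simp
    · have : (F ⊔ SimpleGraph.edge u b).neighborSet x = F.neighborSet x := by
        ext y
        simp only [SimpleGraph.mem_neighborSet, add_adj F hub]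
        grind
      rw [this]
      simp [h1, h2]
end LF

namespace LF
open Classical

structure Ctx {V : Type*} (n l m : ℕ) (B : Finset V) (p : V) (e : ℕ → V) (idx : V → ℕ) : Prop where
  hp : p ∉ B
  he : ∀ x < n, e x ∉ B ∧ e x ≠ p ∧ idx (e x) = x
  hidx : ∀ v, v ∉ B → v ≠ p → idx v < n ∧ e (idx v) = v
  hl : 1 ≤ l
  hm : n + l = 2 * m

def sig (n l x y : ℕ) : ℕ := if x + y < n then x + y + l else x + y - n

def sl (l i x : ℕ) : ℕ :=
  (if x ≤ 2 * i ∧ 2 * i < x + l then 1 else 0) + (if x ≤ 2 * i + 1 ∧ 2 * i + 1 < x + l then 1 else 0)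

def rk (n l i x : ℕ) : ℕ :=
  if x ≤ 2 * i then (4 * (x : ℤ) - 2 * (2 * i - l) - 1).natAbs
  else (4 * (x : ℤ) - 2 * (2 * i + n) - 1).natAbs

theorem sig_comm (n l x y : ℕ) : sig n l x y = sig n l y x := by
  unfold sig; rw [add_comm x y]

theorem sig_lt {n l m x y : ℕ} (hm : n + l = 2 * m) (hl : 1 ≤ l) (hx : x < n) (hy : y < n) :
    sig n l x y / 2 < m := by
  unfold sig; split_ifs <;> omega

theorem rk_ne {n l m i x y : ℕ} (hm : n + l = 2 * m) (hl : 1 ≤ l) (hx : x < n) (hy : y < n)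
    (h : sig n l x y / 2 = i) (hxy : y ≠ x) : rk n l i x ≠ rk n l i y := by
  unfold sig at h; unfold rk; split_ifs at h ⊢ <;> omega

theorem rk_pos (n l i x : ℕ) : 0 < rk n l i x := by
  unfold rk; split_ifs <;> omega

theorem rk_uniq {n l m i x y z : ℕ} (hm : n + l = 2 * m) (hl : 1 ≤ l) (hx : x < n) (hy : y < n)
    (hz : z < n) (h : sig n l x y / 2 = i) (h' : sig n l x z / 2 = i)
    (h1 : y = x ∨ rk n l i y < rk n l i x) (h2 : z = x ∨ rk n l i z < rk n l i x) : y = z := by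
  unfold sig at h h'; unfold rk at h1 h2; split_ifs at h h' h1 h2 <;> omega

theorem card_slots {n l m i x : ℕ} (hm : n + l = 2 * m) (hl : 1 ≤ l) (hx : x < n) (hi : i < m) :
    ((Finset.range n).filter (fun y => sig n l x y / 2 = i)).card + sl l i x = 2 := by
  have : ((Finset.range n).filter (fun y => sig n l x y / 2 = i)).card =
      ((({2 * i, 2 * i + 1} : Finset ℕ)).filter (fun s => ¬ (x ≤ s ∧ s < x + l))).card := by
    apply Finset.card_nbij' (fun y => sig n l x y) (fun s => if s < x then s + n - x else s - l - x)
    · intro y hy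
      simp only [Finset.mem_coe, Finset.mem_filter, Finset.mem_range, Finset.mem_insert, Finset.mem_singleton, sig] at hy ⊢
      grind
    · intro y hy
      simp only [Finset.mem_coe, Finset.mem_filter, Finset.mem_range, Finset.mem_insert, Finset.mem_singleton, sig] at hy ⊢
      grind
    · intro y hy
      simp only [Finset.mem_coe, Finset.mem_filter, Finset.mem_range, Finset.mem_insert, Finset.mem_singleton, sig] at hy ⊢
      grind
    · intro y hy
      simp only [Finset.mem_coe, Finset.mem_filter, Finset.mem_range, Finset.mem_insert, Finset.mem_singleton, sig] at hy ⊢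
      grind
  rw [this, Finset.filter_insert, Finset.filter_singleton]
  unfold sl
  split_ifs <;> simp <;> omega

theorem card_apex {n l m i : ℕ} (hm : n + l = 2 * m) (hl : 1 ≤ l) (hi : i < m) :
    ((Finset.range n).filter (fun x => sig n l x x / 2 = i)).card =
      (if l ≤ 2 * i + 1 then 1 else 0) + (if 2 * i + 2 ≤ n then 1 else 0) := by
  have : (Finset.range n).filter (fun x => sig n l x x / 2 = i) =
      (if l ≤ 2 * i + 1 then {(2 * i + 1 - l) / 2} else ∅) ∪
      (if 2 * i + 2 ≤ n then {i + (n + 1) / 2} else ∅) := by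
    ext x
    simp only [Finset.mem_filter, Finset.mem_range, sig, Finset.mem_union]
    split_ifs <;> simp only [Finset.mem_singleton, Finset.notMem_empty] <;> grind
  rw [this, Finset.card_union_of_disjoint]
  · split_ifs <;> simp
  · split_ifs <;> simp
    omega

noncomputable def col {V : Type*} (n l : ℕ) (p : V) (idx : V → ℕ) (v w : V) : ℕ :=
  sig n l (if v = p then idx w else idx v) (if w = p then idx v else idx w) / 2

noncomputable def Z {V : Type*} (n l : ℕ) (B : Finset V) (p : V) (idx : V → ℕ) (i : ℕ) :
    SimpleGraph V where
  Adj v w := v ≠ w ∧ v ∉ B ∧ w ∉ B ∧ col n l p idx v w = i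
  symm := ⟨by
    rintro v w ⟨h1, h2, h3, h4⟩
    refine ⟨h1.symm, h3, h2, ?_⟩
    rw [← h4]; unfold col; rw [sig_comm]⟩
  loopless := ⟨fun v h => h.1 rfl⟩

variable {V : Type*} {n l m : ℕ} {B : Finset V} {p : V} {e : ℕ → V} {idx : V → ℕ}

/-- neighbours of `e x` -/
theorem Z_adj_e (h : Ctx n l m B p e idx) {i x : ℕ} (hx : x < n) (w : V) :
    (Z n l B p idx i).Adj (e x) w ↔
      ∃ y < n, sig n l x y / 2 = i ∧ w = if y = x then p else e y := by
  obtain ⟨a1, a2, a3⟩ := h.he x hx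
  constructor
  · rintro ⟨h1, h2, h3, h4⟩
    unfold col at h4
    rw [if_neg a2, a3] at h4
    by_cases hw : w = p
    · rw [if_pos hw] at h4
      exact ⟨x, hx, h4, by simp [hw]⟩
    · rw [if_neg hw] at h4
      obtain ⟨b1, b2⟩ := h.hidx w h3 hw
      refine ⟨idx w, b1, h4, ?_⟩
      rw [if_neg, b2]
      intro hh
      rw [hh] at b2
      exact h1 b2
  · rintro ⟨y, hy, hs, rfl⟩
    obtain ⟨b1, b2, b3⟩ := h.he y hy
    by_cases hyx : y = x
    · subst hyx
      rw [if_pos rfl]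
      refine ⟨a2, a1, h.hp, ?_⟩
      simp only [col, if_neg a2, a3, if_true, hs]
    · rw [if_neg hyx]
      refine ⟨fun hh => ?_, a1, b1, ?_⟩
      · apply hyx; rw [← a3, hh, b3]
      · simp only [col, if_neg a2, if_neg b2, a3, b3, hs]

theorem Z_adj_p (h : Ctx n l m B p e idx) {i : ℕ} (w : V) :
    (Z n l B p idx i).Adj p w ↔ ∃ y < n, sig n l y y / 2 = i ∧ w = e y := by
  constructor
  · rintro ⟨h1, h2, h3, h4⟩
    obtain ⟨b1, b2⟩ := h.hidx w h3 h1.symm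
    refine ⟨idx w, b1, ?_, b2.symm⟩
    simpa [col, h1.symm] using h4
  · rintro ⟨y, hy, hs, rfl⟩
    obtain ⟨b1, b2, b3⟩ := h.he y hy
    refine ⟨b2.symm, h.hp, b1, ?_⟩
    simpa [col, b2, b3] using hs

theorem Z_not_B {i : ℕ} {b w : V} (hb : b ∈ B) : ¬ (Z n l B p idx i).Adj b w := fun h => h.2.1 hb

theorem dg_Z_B {i : ℕ} {b : V} (hb : b ∈ B) : dg (Z n l B p idx i) b = 0 := by
  unfold dg
  have : (Z n l B p idx i).neighborSet b = ∅ := by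
    ext w; simpa using Z_not_B hb
  rw [this, Set.ncard_empty]

theorem dg_Z_e (h : Ctx n l m B p e idx) {i x : ℕ} (hx : x < n) (hi : i < m) :
    dg (Z n l B p idx i) (e x) + sl l i x = 2 := by
  rw [← card_slots h.hm h.hl hx hi]
  congr 1
  unfold dg
  have : (Z n l B p idx i).neighborSet (e x) =
     ((((Finset.range n).filter (fun y => sig n l x y / 2 = i)).image
        (fun y => if y = x then p else e y) : Finset V) : Set V) := by
    ext w
    rw [SimpleGraph.mem_neighborSet, Z_adj_e h hx]
    simp only [Finset.coe_image, Set.mem_image, Finset.mem_coe, Finset.mem_filter, Finset.mem_range]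
    constructor
    · rintro ⟨y, a, b, c⟩; exact ⟨y, ⟨a, b⟩, c.symm⟩
    · rintro ⟨y, ⟨a, b⟩, c⟩; exact ⟨y, a, b, c.symm⟩
  rw [this, Set.ncard_coe_finset, Finset.card_image_of_injOn]
  intro y hy z hz hyz
  simp only [Finset.coe_filter, Finset.mem_range, Set.mem_ofPred_eq] at hy hz
  have b := h.he y hy.1
  have c := h.he z hz.1
  have b' := b.2.2
  have c' := c.2.2
  dsimp only at hyz
  split_ifs at hyz with h1 h2 h2
  · omega
  · exact absurd hyz.symm c.2.1
  · exact absurd hyz b.2.1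
  · rw [← b', ← c', hyz]

theorem dg_Z_p (h : Ctx n l m B p e idx) {i : ℕ} (hi : i < m) :
    dg (Z n l B p idx i) p = (if l ≤ 2 * i + 1 then 1 else 0) + (if 2 * i + 2 ≤ n then 1 else 0) := by
  rw [← card_apex h.hm h.hl hi]
  unfold dg
  have : (Z n l B p idx i).neighborSet p =
     ((((Finset.range n).filter (fun x => sig n l x x / 2 = i)).image e : Finset V) : Set V) := by
    ext w
    rw [SimpleGraph.mem_neighborSet, Z_adj_p h]
    simp only [Finset.coe_image, Set.mem_image, Finset.mem_coe, Finset.mem_filter, Finset.mem_range]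
    constructor
    · rintro ⟨y, a, b, c⟩; exact ⟨y, ⟨a, b⟩, c.symm⟩
    · rintro ⟨y, ⟨a, b⟩, c⟩; exact ⟨y, a, b, c.symm⟩
  rw [this, Set.ncard_coe_finset, Finset.card_image_of_injOn]
  intro y hy z hz hyz
  simp only [Finset.coe_filter, Finset.mem_range, Set.mem_ofPred_eq] at hy hz
  have b' := (h.he y hy.1).2.2
  have c' := (h.he z hz.1).2.2
  rw [← b', ← c', hyz]

theorem Z_dg_le (h : Ctx n l m B p e idx) {i : ℕ} (hi : i < m) (v : V) :
    dg (Z n l B p idx i) v ≤ 2 := by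
  by_cases hb : v ∈ B
  · rw [dg_Z_B hb]; omega
  by_cases hv : v = p
  · rw [hv, dg_Z_p h hi]; split_ifs <;> omega
  · obtain ⟨h1, h2⟩ := h.hidx v hb hv
    have := dg_Z_e h h1 hi
    rw [h2] at this
    omega

theorem Z_acyclic (h : Ctx n l m B p e idx) (i : ℕ) : (Z n l B p idx i).IsAcyclic := by
  obtain ⟨f, hf⟩ : ∃ f : V → ℕ, f = fun v => if v = p then 0 else rk n l i (idx v) := ⟨_, rfl⟩
  have hfp : f p = 0 := by simp [hf]
  have hrk : ∀ x < n, f (e x) = rk n l i x := by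
    intro x hx
    obtain ⟨a1, a2, a3⟩ := h.he x hx
    simp [hf, a2, a3]
  have key : ∀ x < n, ∀ y < n,
      (f (if y = x then p else e y)) < rk n l i x →
      y = x ∨ rk n l i y < rk n l i x := by
    intro x hx y hy hlt
    by_cases hyx : y = x
    · exact Or.inl hyx
    · rw [if_neg hyx, hrk y hy] at hlt
      exact Or.inr hlt
  apply rank_acyclic _ f
  · intro v w hvw
    by_cases hv : v = p
    · rw [hv] at hvw ⊢
      obtain ⟨y, hy, hs, rfl⟩ := (Z_adj_p h w).1 hvw
      rw [hrk y hy, hfp]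
      have := rk_pos n l i y
      omega
    · obtain ⟨b1, b2⟩ := h.hidx v hvw.2.1 hv
      generalize idx v = x at *
      subst b2
      rw [hrk x b1]
      obtain ⟨y, hy, hs, rfl⟩ := (Z_adj_e h b1 w).1 hvw
      have := rk_pos n l i x
      by_cases hyx : y = x
      · rw [if_pos hyx, hfp]; omega
      · rw [if_neg hyx, hrk y hy]
        exact rk_ne h.hm h.hl b1 hy hs hyx
  · intro v a b hva hvb hlt1 hlt2
    by_cases hv : v = p
    · rw [hv, hfp] at hlt1; omega
    · obtain ⟨b1, b2⟩ := h.hidx v hva.2.1 hv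
      generalize idx v = x at *
      subst b2
      rw [hrk x b1] at hlt1 hlt2
      obtain ⟨y, hy, hs, rfl⟩ := (Z_adj_e h b1 a).1 hva
      obtain ⟨z, hz, hs', rfl⟩ := (Z_adj_e h b1 b).1 hvb
      rw [rk_uniq h.hm h.hl b1 hy hz hs hs' (key x b1 y hy hlt1) (key x b1 z hz hlt2)]

end LF

namespace LF
open Classical

noncomputable def bn {V : Type*} (B : Finset V) (F : SimpleGraph V) (v : V) : Finset V :=
  B.filter (fun b => F.Adj v b)

structure PF {V : Type*} (n l : ℕ) (B : Finset V) (p : V) (idx : V → ℕ) (i : ℕ)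
    (F : SimpleGraph V) : Prop where
  ac : F.IsAcyclic
  dle : ∀ v, dg F v ≤ 2
  jj : ∀ u v, u ∉ B → v ∉ B → (F.Adj u v ↔ (Z n l B p idx i).Adj u v)
  bb : ∀ u ∈ B, ∀ v ∈ B, ¬ F.Adj u v

structure Ext {V : Type*} (n l : ℕ) (B : Finset V) (p : V) (idx : V → ℕ) (i : ℕ)
    (F : SimpleGraph V) (u b : V) (F' : SimpleGraph V) : Prop where
  pf : PF n l B p idx i F'
  bu : bn B F' u = insert b (bn B F u)
  nb : b ∉ bn B F u
  bo : ∀ v, v ≠ u → v ∉ B → bn B F' v = bn B F v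
  sm : ∑ x ∈ B, dg F' x = ∑ x ∈ B, dg F x + 1
  du : dg F' u = dg F u + 1
  dv : ∀ v ∈ B, dg F' v = dg F v + if v = b then 1 else 0

variable {V : Type*} [Fintype V] {n l m : ℕ} {B : Finset V} {p : V} {e : ℕ → V} {idx : V → ℕ}

theorem PF_Z (h : Ctx n l m B p e idx) {i : ℕ} (hi : i < m) :
    PF n l B p idx i (Z n l B p idx i) :=
  ⟨Z_acyclic h i, Z_dg_le h hi, fun _ _ _ _ => Iff.rfl, fun _ hu _ _ => Z_not_B hu⟩

theorem bn_Z (i : ℕ) (v : V) : bn B (Z n l B p idx i) v = ∅ := by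
  unfold bn
  rw [Finset.filter_eq_empty_iff]
  intro b hb h
  exact h.2.2.1 hb

theorem dg_split {i : ℕ} {F : SimpleGraph V} (hF : PF n l B p idx i F) {v : V} (hv : v ∉ B) :
    dg F v = dg (Z n l B p idx i) v + (bn B F v).card := by
  unfold dg
  have : F.neighborSet v = (Z n l B p idx i).neighborSet v ∪ (bn B F v : Set V) := by
    ext w
    simp only [SimpleGraph.mem_neighborSet, Set.mem_union, bn, Finset.mem_coe, Finset.mem_filter]
    by_cases hw : w ∈ B
    · constructor
      · exact fun h => Or.inr ⟨hw, h⟩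
      · rintro (h | h)
        · exact absurd hw h.2.2.1
        · exact h.2
    · rw [hF.jj v w hv hw]; tauto
  rw [this, Set.ncard_union_eq _ (Set.toFinite _) (Set.toFinite _), Set.ncard_coe_finset]
  rw [Set.disjoint_left]
  intro w h1 h2
  simp only [bn, Finset.mem_coe, Finset.mem_filter] at h2
  exact h1.2.2.1 h2.1

theorem ext_add {i : ℕ} {F : SimpleGraph V} (hF : PF n l B p idx i F) {u b : V} (hu : u ∉ B)
    (hb : b ∈ B) (hr : ¬ F.Reachable u b) (du : dg F u ≤ 1) (db : dg F b ≤ 1) :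
    Ext n l B p idx i F u b (F ⊔ SimpleGraph.edge u b) := by
  have hub : u ≠ b := by rintro rfl; exact hu hb
  have hn : ¬ F.Adj u b := fun h => hr h.reachable
  have hd := dg_add F hub hn
  have ha := add_adj F hub
  refine ⟨⟨hF.ac.sup_edge_of_not_reachable hr, ?_, ?_, ?_⟩, ?_, ?_, ?_, ?_, ?_, ?_⟩
  · intro v
    rw [hd]
    have := hF.dle v
    by_cases h1 : v = u
    · simp [h1]; omega
    · by_cases h2 : v = b
      · simp [h2]; omega
      · simp [h1, h2, this]
  · intro x y hx hy
    rw [ha, hF.jj x y hx hy]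
    constructor
    · rintro (h | ⟨rfl, rfl⟩ | ⟨rfl, rfl⟩)
      · exact h
      · exact absurd hb hy
      · exact absurd hb hx
    · exact Or.inl
  · intro x hx y hy
    rw [ha]
    rintro (h | ⟨rfl, rfl⟩ | ⟨rfl, rfl⟩)
    · exact hF.bb x hx y hy h
    · exact hu hx
    · exact hu hy
  · ext w
    simp only [bn, Finset.mem_filter, Finset.mem_insert, ha]
    grind
  · simp [bn, hn]
  · intro v hvu hv
    ext w
    simp only [bn, Finset.mem_filter, ha]
    grind
  · rw [Finset.sum_congr rfl (fun x _ => hd x), Finset.sum_add_distrib]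
    congr 1
    rw [Finset.sum_eq_single_of_mem b hb]
    · simp
    · intro x hx hxb
      rw [if_neg]
      rintro (rfl | rfl)
      · exact hu hx
      · exact hxb rfl
  · rw [hd]; simp
  · intro v hv
    rw [hd]
    have : v ≠ u := by rintro rfl; exact hu hv
    simp [this]

theorem pick1 {i : ℕ} {F : SimpleGraph V} (hF : PF n l B p idx i F) {u : V} (hu : u ∉ B)
    (du : dg F u ≤ 1) (R : Finset V) (hR : R ⊆ B)
    (hs : ∑ x ∈ R, dg F x + dg F u < 2 * R.card) :
    ∃ b ∈ R, ∃ F', Ext n l B p idx i F u b F' := by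
  by_contra hcon
  have hre : ∀ y ∈ R, dg F y ≤ 1 → F.Reachable u y := by
    intro y hy hd
    by_contra hr
    exact hcon ⟨y, hy, _, ext_add hF hu (hR hy) hr du hd⟩
  have huS : u ∉ R.filter (fun y => dg F y ≤ 1) := by
    intro h
    exact hu (hR (Finset.mem_filter.1 h).1)
  have := weight_le F hF.ac hF.dle u (insert u (R.filter (fun y => dg F y ≤ 1))) (by
    intro x hx
    rw [Finset.mem_insert, Finset.mem_filter] at hx
    rcases hx with rfl | hx
    · exact SimpleGraph.Reachable.refl _
    · exact hre x hx.1 hx.2)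
  rw [Finset.sum_insert huS, Finset.sum_filter] at this
  have h2 : ∑ x ∈ R, (if dg F x ≤ 1 then 2 - dg F x else 0) + ∑ x ∈ R, dg F x = 2 * R.card := by
    rw [← Finset.sum_add_distrib, Finset.sum_congr rfl (g := fun _ => 2)]
    · simp [mul_comm]
    · intro x _
      have := hF.dle x
      split_ifs <;> omega
  omega

theorem fill {i : ℕ} {F : SimpleGraph V} (hF : PF n l B p idx i F) {u : V} (hu : u ∉ B)
    (hbn : bn B F u = ∅) {s : ℕ} (hs1 : 1 ≤ s) (hs : dg F u + s = 2) (R1 R : Finset V)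
    (hR1 : R1 ⊆ R) (hR : R ⊆ B)
    (h1 : ∑ x ∈ R1, dg F x + dg F u < 2 * R1.card)
    (h2 : s = 2 → ∑ x ∈ R, dg F x + 2 < 2 * R.card) :
    ∃ F', PF n l B p idx i F' ∧ bn B F' u ⊆ R ∧ (bn B F' u).card = s ∧
      (∀ v, v ≠ u → v ∉ B → bn B F' v = bn B F v) ∧
      ∑ x ∈ B, dg F' x = ∑ x ∈ B, dg F x + s ∧ (∃ b ∈ R1, 1 ≤ dg F' b) ∧
      (∀ v ∈ B, dg F v ≤ dg F' v) := by
  obtain ⟨b, hb, F1, e1⟩ := pick1 hF hu (by omega) R1 (hR1.trans hR) h1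
  have hb1 := e1.dv b (hR (hR1 hb))
  rw [if_pos rfl] at hb1
  have hbu := e1.bu
  rw [hbn] at hbu
  obtain rfl | rfl : s = 1 ∨ s = 2 := by omega
  · refine ⟨F1, e1.pf, ?_, ?_, e1.bo, e1.sm, ⟨b, hb, by omega⟩, ?_⟩
    · rw [hbu]; simpa using hR1 hb
    · rw [hbu]; simp
    · intro v hv; rw [e1.dv v hv]; omega
  · have hsum : ∑ x ∈ R, dg F1 x ≤ ∑ x ∈ R, dg F x + 1 := by
      rw [Finset.sum_congr rfl (fun x hx => e1.dv x (hR hx)), Finset.sum_add_distrib]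
      simp only [Finset.sum_ite_eq', hR1 hb, if_true, le_refl]
    have hdu := e1.du
    obtain ⟨c, hc, F2, e2⟩ := pick1 e1.pf hu (by omega) R hR (by have := h2 rfl; omega)
    have hcu := e2.bu
    have hnb := e2.nb
    rw [hbu] at hcu hnb
    refine ⟨F2, e2.pf, ?_, ?_, ?_, ?_, ⟨b, hb, ?_⟩, ?_⟩
    · rw [hcu]
      intro x hx
      simp only [Finset.mem_insert, Finset.notMem_empty, or_false] at hx
      rcases hx with rfl | rfl
      · exact hc
      · exact hR1 hb
    · rw [hcu, Finset.card_insert_of_notMem hnb]; simp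
    · intro v h1 h2
      rw [e2.bo v h1 h2, e1.bo v h1 h2]
    · rw [e2.sm, e1.sm]
    · rw [e2.dv b (hR (hR1 hb))]; omega
    · intro v hv; rw [e2.dv v hv, e1.dv v hv]; omega

theorem T_bounds (l i u : ℕ) (hl : 1 ≤ l) :
    (u + l ≤ 2 * i + 1 → ∑ x ∈ Finset.range u, sl l i x = 0) ∧
    (2 * i + 2 ≤ u + l → ∑ x ∈ Finset.range u, sl l i x + 4 * i + 3 ≤ 2 * u + 2 * l) ∧
    (∑ x ∈ Finset.range u, sl l i x ≤ 2 * u) ∧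
    (u ≤ 2 * i + 1 ∨ ∑ x ∈ Finset.range u, sl l i x ≤ 4 * i + 3) := by
  induction u with
  | zero => simp; omega
  | succ u ih =>
    rw [Finset.sum_range_succ]
    obtain ⟨h1, h2, h3, h4⟩ := ih
    unfold sl at *
    split_ifs <;> omega

structure Inv {V : Type*} (n l : ℕ) (B : Finset V) (p : V) (e : ℕ → V) (idx : V → ℕ) (i : ℕ)
    (R : ℕ → Finset V) (u : ℕ) (F : SimpleGraph V) : Prop where
  pf : PF n l B p idx i F
  lo : ∀ x < u, bn B F (e x) ⊆ R x ∧ (bn B F (e x)).card = sl l i x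
  hi : ∀ x < n, u ≤ x → bn B F (e x) = ∅
  hp : bn B F p = ∅
  sm : ∑ x ∈ B, dg F x = ∑ x ∈ Finset.range u, sl l i x

theorem colour_step (h : Ctx n l m B p e idx) {i : ℕ} (hi : i < m) (R : ℕ → Finset V)
    (hRB : ∀ x < n, R x ⊆ B) (hRc : ∀ x < n, l ≤ (R x).card + (2 * i - x))
    (hsp : 2 * i + 1 < n → l + 1 ≤ (R (2 * i + 1)).card ∨ ∃ z ∈ R (2 * i), z ∉ R (2 * i + 1)) 
    (u : ℕ) (hu : u < n) (F : SimpleGraph V) (hI : Inv n l B p e idx i R u F)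
    (hc : u = 2 * i + 1 → l + 1 ≤ (R (2 * i + 1)).card ∨ ∃ b ∈ B, b ∉ R (2 * i + 1) ∧ 1 ≤ dg F b) :
    ∃ F', Inv n l B p e idx i R (u + 1) F' ∧
     (u + 1 = 2 * i + 1 → u + 1 < n →
       l + 1 ≤ (R (2 * i + 1)).card ∨ ∃ b ∈ B, b ∉ R (2 * i + 1) ∧ 1 ≤ dg F' b) := by
  have hl := h.hl
  obtain ⟨a1, a2, a3⟩ := h.he u hu
  have hbn := hI.hi u hu le_rfl
  have hdz := dg_Z_e h hu hi
  have hds := dg_split hI.pf a1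
  rw [hbn, Finset.card_empty, add_zero] at hds
  rw [← hds] at hdz
  have hRu := hRc u hu
  obtain ⟨t1, t2, t3, t4⟩ := T_bounds l i u hl
  have hsm := hI.sm
  have hsub : ∑ x ∈ R u, dg F x ≤ ∑ x ∈ B, dg F x := Finset.sum_le_sum_of_subset (hRB u hu)
  have hslv : sl l i u = (if u ≤ 2 * i ∧ 2 * i < u + l then 1 else 0) + 
    (if u ≤ 2 * i + 1 ∧ 2 * i + 1 < u + l then 1 else 0) := rfl
  by_cases hs0 : sl l i u = 0
  · refine ⟨F, ⟨hI.pf, ?_, ?_, hI.hp, ?_⟩, ?_⟩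
    · intro x hx
      by_cases hxu : x = u
      · subst hxu
        rw [hbn, hs0]; simp
      · exact hI.lo x (by omega)
    · intro x hx hux
      exact hI.hi x hx (by omega)
    · rw [Finset.sum_range_succ, hs0, hsm, add_zero]
    · intro h1 h2
      exfalso
      split_ifs at hslv <;> omega
  · have main : ∀ R1 ⊆ R u, ∑ x ∈ R1, dg F x + dg F (e u) < 2 * R1.card →
        ∃ F', Inv n l B p e idx i R (u + 1) F' ∧ (∃ b ∈ R1, 1 ≤ dg F' b) ∧
          (∀ v ∈ B, dg F v ≤ dg F' v) := by
      intro R1 hR1 hlt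
      obtain ⟨F', f1, f2, f3, f4, f5, f6, f7⟩ := fill hI.pf a1 hbn (by omega) hdz R1 (R u) hR1
        (hRB u hu) hlt (by
          intro hs2
          split_ifs at hslv <;> omega)
      have hne : ∀ x < n, x ≠ u → e x ≠ e u := by
        intro x hx hxu hh
        apply hxu
        rw [← a3, ← hh, (h.he x hx).2.2]
      refine ⟨F', ⟨f1, ?_, ?_, ?_, ?_⟩, f6, f7⟩
      · intro x hx
        by_cases hxu : x = u
        · subst hxu
          exact ⟨f2, f3⟩
        · rw [f4 _ (hne x (by omega) hxu) (h.he x (by omega)).1]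
          exact hI.lo x (by omega)
      · intro x hx hux
        rw [f4 _ (hne x hx (by omega)) (h.he x hx).1]
        exact hI.hi x hx (by omega)
      · rw [f4 p a2.symm h.hp, hI.hp]
      · rw [f5, Finset.sum_range_succ, hsm]
    have all : ∑ x ∈ R u, dg F x + dg F (e u) < 2 * (R u).card := by
      by_cases hu1 : u = 2 * i + 1
      · rcases hc hu1 with hc | ⟨b, hb, hb1, hb2⟩
        · rw [← hu1] at hc
          split_ifs at hslv <;> omega
        · rw [← hu1] at hb1
          have : ∑ x ∈ R u, dg F x + dg F b ≤ ∑ x ∈ B, dg F x := by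
            rw [add_comm, ← Finset.sum_insert hb1]
            apply Finset.sum_le_sum_of_subset
            exact Finset.insert_subset hb (hRB u hu)
          split_ifs at hslv <;> omega
      · split_ifs at hslv <;> omega
    by_cases hspec : u = 2 * i ∧ u + 1 < n
    · obtain ⟨hs1, hs2⟩ := hspec
      rcases hsp (by omega) with h5 | ⟨z, hz, hz'⟩
      · obtain ⟨F', g1, g2, g3⟩ := main _ (Finset.Subset.refl _) all
        exact ⟨F', g1, fun _ _ => Or.inl h5⟩
      · rw [← hs1] at hz
        have hzB := hRB u hu hz
        by_cases hdz1 : 1 ≤ dg F z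
        · obtain ⟨F', g1, g2, g3⟩ := main _ (Finset.Subset.refl _) all
          exact ⟨F', g1, fun _ _ => Or.inr ⟨z, hzB, hz', le_trans hdz1 (g3 z hzB)⟩⟩
        · obtain ⟨F', g1, ⟨b, hb, hb'⟩, g3⟩ := main {z} (by simpa using hz) (by simp; omega)
          rw [Finset.mem_singleton] at hb
          subst hb
          exact ⟨F', g1, fun _ _ => Or.inr ⟨b, hzB, hz', hb'⟩⟩
    · obtain ⟨F', g1, g2, g3⟩ := main _ (Finset.Subset.refl _) all
      exact ⟨F', g1, fun q1 q2 => absurd ⟨by omega, q2⟩ hspec⟩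

theorem colour (h : Ctx n l m B p e idx) {i : ℕ} (hi : i < m) (R : ℕ → Finset V)
    (hRB : ∀ x < n, R x ⊆ B) (hRc : ∀ x < n, l ≤ (R x).card + (2 * i - x))
    (hsp : 2 * i + 1 < n → l + 1 ≤ (R (2 * i + 1)).card ∨ ∃ z ∈ R (2 * i), z ∉ R (2 * i + 1)) :
    ∃ F, Inv n l B p e idx i R n F := by
  have : ∀ u ≤ n, ∃ F, Inv n l B p e idx i R u F ∧ (u = 2 * i + 1 → u < n →
      l + 1 ≤ (R (2 * i + 1)).card ∨ ∃ b ∈ B, b ∉ R (2 * i + 1) ∧ 1 ≤ dg F b) := by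
    intro u
    induction u with
    | zero =>
      intro _
      refine ⟨Z n l B p idx i, ⟨PF_Z h hi, by simp, fun x _ _ => bn_Z i _, bn_Z i _, ?_⟩, by omega⟩
      rw [Finset.sum_range_zero]
      exact Finset.sum_eq_zero (fun x hx => dg_Z_B hx)
    | succ u ih =>
      intro hu
      obtain ⟨F, hF, hF'⟩ := ih (by omega)
      exact colour_step h hi R hRB hRc hsp u (by omega) F hF (fun q => hF' q (by omega))
  obtain ⟨F, hF, -⟩ := this n le_rfl
  exact ⟨F, hF⟩

end LF

namespace LF
open Classical

theorem sl_sum_le (l M x : ℕ) : ∑ i ∈ Finset.range M, sl l i x ≤ 2 * M - x := by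
  induction M with
  | zero => simp
  | succ M ih =>
    rw [Finset.sum_range_succ]
    unfold sl at *
    split_ifs <;> omega

variable {V : Type*} [Fintype V] {n l m : ℕ} {B : Finset V} {p : V} {e : ℕ → V} {idx : V → ℕ}

theorem phase1 (h : Ctx n l m B p e idx) (N : ℕ → Finset V) (hNB : ∀ x < n, N x ⊆ B)
    (hN : ∀ x < n, l ≤ (N x).card)
    (hN2 : ∀ x < n, ∀ y < n, x ≠ y → l + 1 ≤ (N x ∪ N y).card) (M : ℕ) (hM : M ≤ m) :
    ∃ F : ℕ → SimpleGraph V, (∀ i < M, Inv n l B p e idx i N n (F i)) ∧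
      ∀ i < M, ∀ i' < M, i ≠ i' → ∀ x < n, Disjoint (bn B (F i) (e x)) (bn B (F i') (e x)) := by
  induction M with
  | zero => exact ⟨fun _ => ⊥, by simp, by simp⟩
  | succ M ih =>
    obtain ⟨F, hF, hD⟩ := ih (by omega)
    obtain ⟨U, hU⟩ : ∃ U : ℕ → Finset V,
      U = fun x => (Finset.range M).biUnion (fun i => bn B (F i) (e x)) := ⟨_, rfl⟩
    have hUc : ∀ x < n, (U x).card ≤ 2 * M - x := by
      intro x hx
      rw [hU]
      refine le_trans Finset.card_biUnion_le (le_trans (le_of_eq ?_) (sl_sum_le l M x))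
      exact Finset.sum_congr rfl (fun i hi => ((hF i (Finset.mem_range.1 hi)).lo x hx).2)
    have hU0 : ∀ x < n, 2 * M ≤ x → U x = ∅ := by
      intro x hx hMx
      have := hUc x hx
      rw [← Finset.card_eq_zero]; omega
    obtain ⟨F', hF'⟩ := colour h (i := M) (by omega) (fun x => N x \ U x)
      (fun x hx => Finset.sdiff_subset.trans (hNB x hx))
      (by
        intro x hx
        have h1 := hUc x hx
        have h2 := hN x hx
        have h3 := Finset.le_card_sdiff (U x) (N x)
        omega)
      (by
        intro hlt
        rw [hU0 _ hlt (by omega), hU0 (2 * M) (by omega) le_rfl, Finset.sdiff_empty,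
          Finset.sdiff_empty]
        by_cases hs : N (2 * M) ⊆ N (2 * M + 1)
        · left
          have := hN2 (2 * M) (by omega) (2 * M + 1) hlt (by omega)
          rwa [Finset.union_eq_right.2 hs] at this
        · right
          rw [Finset.not_subset] at hs
          exact hs)
    have hdis : ∀ i < M, ∀ x < n, Disjoint (bn B (F i) (e x)) (bn B F' (e x)) := by
      intro i hi x hx
      rw [Finset.disjoint_left]
      intro b hb hb'
      have := (hF'.lo x hx).1 hb'
      rw [Finset.mem_sdiff] at this
      apply this.2
      rw [hU]
      exact Finset.mem_biUnion.2 ⟨i, Finset.mem_range.2 hi, hb⟩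
    refine ⟨fun i => if i < M then F i else F', ?_, ?_⟩
    · intro i hi
      by_cases hiM : i < M
      · simp only [if_pos hiM]; exact hF i hiM
      · simp only [if_neg hiM]
        obtain rfl : i = M := by omega
        exact ⟨hF'.pf, fun x hx => ⟨(hF'.lo x hx).1.trans Finset.sdiff_subset, (hF'.lo x hx).2⟩,
          hF'.hi, hF'.hp, hF'.sm⟩
    · intro i hi i' hi' hne x hx
      by_cases hiM : i < M
      · by_cases hiM' : i' < M
        · simp only [if_pos hiM, if_pos hiM']
          exact hD i hiM i' hiM' hne x hx
        · simp only [if_pos hiM, if_neg hiM']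
          exact hdis i hiM x hx
      · simp only [if_neg hiM, if_pos (show i' < M by omega)]
        exact (hdis i' (by omega) x hx).symm

structure Fam {V : Type*} (n l m : ℕ) (B : Finset V) (p : V) (e : ℕ → V) (idx : V → ℕ)
    (N : ℕ → Finset V) (Np : Finset V) (a : ℕ → ℕ) (F : ℕ → SimpleGraph V) : Prop where
  pf : ∀ i < m, PF n l B p idx i (F i)
  lo : ∀ i < m, ∀ x < n, bn B (F i) (e x) ⊆ N x ∧ (bn B (F i) (e x)).card = sl l i x
  dj : ∀ i < m, ∀ i' < m, i ≠ i' → ∀ x < n, Disjoint (bn B (F i) (e x)) (bn B (F i') (e x))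
  ps : ∀ i < m, bn B (F i) p ⊆ Np
  pc : ∀ i < m, (bn B (F i) p).card = a i
  pd : ∀ i < m, ∀ i' < m, i ≠ i' → Disjoint (bn B (F i) p) (bn B (F i') p)
  sm : ∀ i < m, ∑ x ∈ B, dg (F i) x = ∑ x ∈ Finset.range n, sl l i x + a i

def ap (n l g i : ℕ) : ℕ :=
  (if 2 * i + 2 ≤ l ∧ l ≤ g + 1 + 2 * i then 1 else 0) +
  (if n + 1 ≤ 2 * i + 2 ∧ 2 * i + 2 ≤ n + g then 1 else 0)

theorem ap_zero (n l i : ℕ) : ap n l 0 i = 0 := by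
  unfold ap; split_ifs <;> omega

theorem ap_step {n l m g : ℕ} (hm : n + l = 2 * m) (hg : g < l) :
    ∃ i0 < m, (ap n l (g + 1) i0 = ap n l g i0 + 1 ∧
      (2 * i0 + 2 + g = l ∨ 2 * i0 + 2 = n + g + 1)) ∧
      ∀ i < m, i ≠ i0 → ap n l (g + 1) i = ap n l g i := by
  by_cases hpar : (l + g) % 2 = 0
  · refine ⟨(l - 2 - g) / 2, by omega, ⟨?_, by omega⟩, ?_⟩
    · unfold ap; split_ifs <;> omega
    · intro i hi hne
      unfold ap; split_ifs <;> omega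
  · refine ⟨(n + g - 1) / 2, by omega, ⟨?_, by omega⟩, ?_⟩
    · unfold ap; split_ifs <;> omega
    · intro i hi hne
      unfold ap; split_ifs <;> omega

theorem phase2 (h : Ctx n l m B p e idx) (N : ℕ → Finset V) (hNB : ∀ x < n, N x ⊆ B)
    (hN : ∀ x < n, l ≤ (N x).card)
    (hN2 : ∀ x < n, ∀ y < n, x ≠ y → l + 1 ≤ (N x ∪ N y).card)
    (Np : Finset V) (hNpB : Np ⊆ B) (hNp : l + 1 ≤ Np.card) (g : ℕ) (hg : g ≤ l) :
    ∃ F : ℕ → SimpleGraph V, Fam n l m B p e idx N Np (ap n l g) F ∧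
      ∑ i ∈ Finset.range m, ap n l g i ≤ g := by
  have hl := h.hl
  have hm := h.hm
  induction g with
  | zero =>
    obtain ⟨F, hF, hD⟩ := phase1 h N hNB hN hN2 m le_rfl
    refine ⟨F, ⟨fun i hi => (hF i hi).pf, fun i hi => (hF i hi).lo, hD, ?_, ?_, ?_, ?_⟩, ?_⟩
    · intro i hi; rw [(hF i hi).hp]; simp
    · intro i hi; rw [(hF i hi).hp, ap_zero]; simp
    · intro i hi i' _ _; rw [(hF i hi).hp]; simp
    · intro i hi; rw [(hF i hi).sm, ap_zero]; simp
    · simp [ap_zero]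
  | succ g ih =>
    obtain ⟨F, hF, hS⟩ := ih (by omega)
    obtain ⟨i0, hi0, ⟨hap, hcase⟩, hoth⟩ := ap_step (n := n) (l := l) (m := m) hm (by omega : g < l)
    obtain ⟨U, hU⟩ : ∃ U, U = (Finset.range m).biUnion (fun i => bn B (F i) p) := ⟨_, rfl⟩
    have hUc : U.card ≤ g := by
      rw [hU]
      refine le_trans Finset.card_biUnion_le (le_trans (le_of_eq ?_) hS)
      exact Finset.sum_congr rfl (fun i hi => hF.pc i (Finset.mem_range.1 hi))
    have hRc := Finset.le_card_sdiff U Np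
    have hRB : Np \ U ⊆ B := Finset.sdiff_subset.trans hNpB
    have hsub : ∑ x ∈ Np \ U, dg (F i0) x ≤ ∑ x ∈ B, dg (F i0) x :=
      Finset.sum_le_sum_of_subset hRB
    rw [hF.sm i0 hi0] at hsub
    have hdp := dg_split (hF.pf i0 hi0) h.hp
    rw [dg_Z_p h hi0, hF.pc i0 hi0] at hdp
    obtain ⟨t1, t2, t3, t4⟩ := T_bounds l i0 n hl
    have hapv : ap n l g i0 = (if 2 * i0 + 2 ≤ l ∧ l ≤ g + 1 + 2 * i0 then 1 else 0) +
      (if n + 1 ≤ 2 * i0 + 2 ∧ 2 * i0 + 2 ≤ n + g then 1 else 0) := rfl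
    have hdp1 : dg (F i0) p ≤ 1 := by
      split_ifs at hdp hapv <;> omega
    have hineq : ∑ x ∈ Np \ U, dg (F i0) x + dg (F i0) p < 2 * (Np \ U).card := by
      split_ifs at hdp hapv <;> omega
    obtain ⟨b, hb, F', hE⟩ := pick1 (hF.pf i0 hi0) h.hp hdp1 (Np \ U) hRB hineq
    rw [Finset.mem_sdiff] at hb
    have hbU : ∀ i < m, b ∉ bn B (F i) p := by
      intro i hi hbi
      apply hb.2
      rw [hU]
      exact Finset.mem_biUnion.2 ⟨i, Finset.mem_range.2 hi, hbi⟩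
    obtain ⟨F2, hF2⟩ : ∃ F2 : ℕ → SimpleGraph V, F2 = Function.update F i0 F' := ⟨_, rfl⟩
    have hF2a : F2 i0 = F' := by simp [hF2]
    have hF2b : ∀ i, i ≠ i0 → F2 i = F i := by
      intro i hi; simp [hF2, hi]
    have hbe : ∀ i < m, ∀ x < n, bn B (F2 i) (e x) = bn B (F i) (e x) := by
      intro i hi x hx
      by_cases hii : i = i0
      · subst hii
        rw [hF2a, hE.bo _ (h.he x hx).2.1 (h.he x hx).1]
      · rw [hF2b i hii]
    refine ⟨F2, ⟨?_, ?_, ?_, ?_, ?_, ?_, ?_⟩, ?_⟩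
    · intro i hi
      by_cases hii : i = i0
      · subst hii; rw [hF2a]; exact hE.pf
      · rw [hF2b i hii]; exact hF.pf i hi
    · intro i hi x hx
      rw [hbe i hi x hx]; exact hF.lo i hi x hx
    · intro i hi i' hi' hne x hx
      rw [hbe i hi x hx, hbe i' hi' x hx]; exact hF.dj i hi i' hi' hne x hx
    · intro i hi
      by_cases hii : i = i0
      · subst hii; rw [hF2a, hE.bu]
        exact Finset.insert_subset hb.1 (hF.ps i hi)
      · rw [hF2b i hii]; exact hF.ps i hi
    · intro i hi
      by_cases hii : i = i0
      · subst hii; rw [hF2a, hE.bu, Finset.card_insert_of_notMem hE.nb, hF.pc i hi, hap]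
      · rw [hF2b i hii, hoth i hi hii]; exact hF.pc i hi
    · intro i hi i' hi' hne
      by_cases hii : i = i0
      · subst hii; rw [hF2a, hE.bu, hF2b i' hne.symm, Finset.disjoint_insert_left]
        exact ⟨hbU i' hi', hF.pd i hi i' hi' hne⟩
      · rw [hF2b i hii]
        by_cases hii' : i' = i0
        · subst hii'; rw [hF2a, hE.bu, Finset.disjoint_insert_right]
          exact ⟨hbU i hi, hF.pd i hi i' hi' hne⟩
        · rw [hF2b i' hii']; exact hF.pd i hi i' hi' hne
    · intro i hi
      by_cases hii : i = i0
      · subst hii; rw [hF2a, hE.sm, hF.sm i hi, hap, add_assoc]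
      · rw [hF2b i hii, hoth i hi hii]; exact hF.sm i hi
    · have h1 : ∑ i ∈ Finset.range m, ap n l (g + 1) i =
          ∑ i ∈ Finset.range m, (ap n l g i + if i = i0 then 1 else 0) := by
        apply Finset.sum_congr rfl
        intro i hi
        by_cases hii : i = i0
        · rw [hii, hap, if_pos rfl]
        · rw [hoth i (Finset.mem_range.1 hi) hii, if_neg hii, add_zero]
      rw [h1, Finset.sum_add_distrib, Finset.sum_ite_eq', if_pos (Finset.mem_range.2 hi0)]
      omega

theorem core (h : Ctx n l m B p e idx) (G : SimpleGraph V)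
    (hcl : ∀ u, u ∉ B → ∀ v, v ∉ B → u ≠ v → G.Adj u v)
    (hN : ∀ x < n, l ≤ (bn B G (e x)).card)
    (hN2 : ∀ x < n, ∀ y < n, x ≠ y → l + 1 ≤ (bn B G (e x) ∪ bn B G (e y)).card)
    (hNp : l + 1 ≤ (bn B G p).card) :
    ∃ F : ℕ → SimpleGraph V, (∀ i < m, F i ≤ G) ∧
      (∀ i < m, (F i).IsAcyclic ∧ ∀ v, ((F i).neighborSet v).ncard ≤ 2) ∧
      (∀ i < m, ∀ i' < m, i ≠ i' → ∀ u v, (F i).Adj u v → ¬ (F i').Adj u v) ∧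
      (∀ u, u ∉ B → ∀ v, v ∉ B → u ≠ v → ∃ i < m, (F i).Adj u v) ∧
      (∀ i < m, ∀ v, v ∉ B → ((F i).neighborSet v).ncard = 2) := by
  have hl := h.hl
  have hm := h.hm
  obtain ⟨F, hF, -⟩ := phase2 h (fun x => bn B G (e x)) (fun x _ => Finset.filter_subset _ _) hN hN2
    (bn B G p) (Finset.filter_subset _ _) hNp l le_rfl
  have hsubG : ∀ i < m, ∀ v, v ∉ B → bn B (F i) v ⊆ bn B G v := by
    intro i hi v hv
    by_cases hvp : v = p
    · rw [hvp]; exact hF.ps i hi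
    · have := hF.lo i hi (idx v) (h.hidx v hv hvp).1
      simp only [(h.hidx v hv hvp).2] at this
      exact this.1
  have hdisj : ∀ i < m, ∀ i' < m, i ≠ i' → ∀ v, v ∉ B → Disjoint (bn B (F i) v) (bn B (F i') v) := by
    intro i hi i' hi' hne v hv
    by_cases hvp : v = p
    · rw [hvp]; exact hF.pd i hi i' hi' hne
    · have := hF.dj i hi i' hi' hne (idx v) (h.hidx v hv hvp).1
      simpa only [(h.hidx v hv hvp).2] using this
  have hle1 : ∀ i < m, ∀ u v, u ∉ B → (F i).Adj u v → G.Adj u v := by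
    intro i hi u v hu ha
    by_cases hv : v ∈ B
    · have := hsubG i hi u hu (Finset.mem_filter.2 ⟨hv, ha⟩)
      exact (Finset.mem_filter.1 this).2
    · exact hcl u hu v hv ha.ne
  have hd1 : ∀ i < m, ∀ i' < m, i ≠ i' → ∀ u v, u ∉ B → (F i).Adj u v → ¬ (F i').Adj u v := by
    intro i hi i' hi' hne u v hu ha ha'
    by_cases hv : v ∈ B
    · exact Finset.disjoint_left.1 (hdisj i hi i' hi' hne u hu)
        (Finset.mem_filter.2 ⟨hv, ha⟩) (Finset.mem_filter.2 ⟨hv, ha'⟩)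
    · have h1 := ((hF.pf i hi).jj u v hu hv).1 ha
      have h2 := ((hF.pf i' hi').jj u v hu hv).1 ha'
      exact hne (h1.2.2.2.symm.trans h2.2.2.2)
  refine ⟨F, ?_, fun i hi => ⟨(hF.pf i hi).ac, (hF.pf i hi).dle⟩, ?_, ?_, ?_⟩
  · intro i hi u v ha
    by_cases hu : u ∈ B
    · by_cases hv : v ∈ B
      · exact absurd ha ((hF.pf i hi).bb u hu v hv)
      · exact (hle1 i hi v u hv ha.symm).symm
    · exact hle1 i hi u v hu ha
  · intro i hi i' hi' hne u v ha ha'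
    by_cases hu : u ∈ B
    · by_cases hv : v ∈ B
      · exact (hF.pf i hi).bb u hu v hv ha
      · exact hd1 i hi i' hi' hne v u hv ha.symm ha'.symm
    · exact hd1 i hi i' hi' hne u v hu ha ha'
  · intro u hu v hv huv
    have hc : col n l p idx u v < m := by
      unfold col
      apply sig_lt hm hl
      · split_ifs with h1
        · exact (h.hidx v hv (by rintro rfl; exact huv h1)).1
        · exact (h.hidx u hu h1).1
      · split_ifs with h1
        · exact (h.hidx u hu (by rintro rfl; exact huv h1.symm)).1
        · exact (h.hidx v hv h1).1
    exact ⟨_, hc, ((hF.pf _ hc).jj u v hu hv).2 ⟨huv, hu, hv, rfl⟩⟩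
  · intro i hi v hv
    have hs := dg_split (hF.pf i hi) hv
    change dg (F i) v = 2
    by_cases hvp : v = p
    · subst hvp
      rw [hs, dg_Z_p h hi, hF.pc i hi]
      unfold ap
      split_ifs <;> omega
    · have h1 := (hF.lo i hi (idx v) (h.hidx v hv hvp).1).2
      have h2 := dg_Z_e h (h.hidx v hv hvp).1 hi
      rw [(h.hidx v hv hvp).2] at h1 h2
      rw [hs, h1, h2]

end LF

theorem stmt6 {V : Type*} [Fintype V] [DecidableEq V] (k j : ℕ) (hk : 1 ≤ k) (hke : Even k)
    (hj1 : 1 ≤ j) (hjk : j ≤ k)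
    (J B : Finset V) (hdisj : Disjoint J B) (hcover : J ∪ B = Finset.univ)
    (hJcard : J.card = j)
    (G : SimpleGraph V)
    (hclique : ∀ u ∈ J, ∀ v ∈ J, u ≠ v → G.Adj u v)
    (hnoB : ∀ u ∈ B, ∀ v ∈ B, ¬ G.Adj u v)
    -- (i): every vertex of J has at least ℓ = k - j + 1 neighbours in B,
    -- and some apex vertex has at least ℓ + 1 of them
    (hdeg : ∀ v ∈ J, k - j + 1 ≤ (G.neighborSet v ∩ ↑B).ncard)
    (hapex : ∃ v ∈ J, k - j + 2 ≤ (G.neighborSet v ∩ ↑B).ncard)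
    -- (ii): joint H-neighbourhoods of pairs in J have at least ℓ + 1 elements
    (hpair : ∀ v ∈ J, ∀ v' ∈ J, v ≠ v' →
      k - j + 2 ≤ (((G.neighborSet v ∪ G.neighborSet v') ∩ ↑B) \ {v, v'}).ncard) :
    ∃ F : Fin (k / 2) → SimpleGraph V,
      (∀ i, F i ≤ G) ∧
      -- each F i is a linear forest
      (∀ i, (F i).IsAcyclic ∧ ∀ v, ((F i).neighborSet v).ncard ≤ 2) ∧
      -- pairwise edge-disjoint
      (∀ i i', i ≠ i' → Disjoint (F i).edgeSet (F i').edgeSet) ∧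
      -- together they contain all edges of the clique on J
      (∀ u ∈ J, ∀ v ∈ J, u ≠ v → ∃ i, (F i).Adj u v) ∧
      -- every vertex of J has degree exactly 2 in each forest
      (∀ i, ∀ v ∈ J, ((F i).neighborSet v).ncard = 2) := by
  obtain ⟨p, hpJ, hp⟩ := hapex
  have hJB : ∀ v, v ∈ J ↔ v ∉ B := by
    intro v
    constructor
    · exact fun h => Finset.disjoint_left.1 hdisj h
    · intro h
      have : v ∈ J ∪ B := by rw [hcover]; exact Finset.mem_univ v
      rcases Finset.mem_union.1 this with h' | h'
      · exact h'
      · exact absurd h' h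
  have hbn : ∀ v, (G.neighborSet v ∩ (B : Set V)).ncard = (LF.bn B G v).card := by
    intro v
    rw [← Set.ncard_coe_finset]
    congr 1
    ext w
    simp [LF.bn, and_comm]
  have hc : (J.erase p).card = j - 1 := by rw [Finset.card_erase_of_mem hpJ, hJcard]
  let E := (J.erase p).equivFinOfCardEq hc
  let e : ℕ → V := fun x => if h : x < j - 1 then (E.symm ⟨x, h⟩ : V) else p
  let idx : V → ℕ := fun v => if h : v ∈ J.erase p then (E ⟨v, h⟩ : ℕ) else 0
  have he : ∀ x < j - 1, e x ∈ J.erase p ∧ idx (e x) = x := by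
    intro x hx
    have h1 : e x = (E.symm ⟨x, hx⟩ : V) := by simp [e, hx]
    have h2 : e x ∈ J.erase p := by rw [h1]; exact (E.symm ⟨x, hx⟩).2
    refine ⟨h2, ?_⟩
    have h3 : idx (e x) = (E ⟨e x, h2⟩ : ℕ) := by simp only [idx, dif_pos h2]
    rw [h3]
    have h4 : (⟨e x, h2⟩ : J.erase p) = E.symm ⟨x, hx⟩ := Subtype.ext h1
    rw [h4, Equiv.apply_symm_apply]
  have ctx : LF.Ctx (j - 1) (k - j + 1) (k / 2) B p e idx := by
    refine ⟨(hJB p).1 hpJ, ?_, ?_, by omega, ?_⟩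
    · intro x hx
      obtain ⟨h1, h2⟩ := he x hx
      rw [Finset.mem_erase] at h1
      exact ⟨(hJB _).1 h1.2, h1.1, h2⟩
    · intro v hv hvp
      have h1 : v ∈ J.erase p := Finset.mem_erase.2 ⟨hvp, (hJB v).2 hv⟩
      have h2 : idx v = (E ⟨v, h1⟩ : ℕ) := by simp only [idx, dif_pos h1]
      have h3 : idx v < j - 1 := by rw [h2]; exact (E ⟨v, h1⟩).2
      refine ⟨h3, ?_⟩
      simp only [e, dif_pos h3]
      have : (⟨idx v, h3⟩ : Fin (j - 1)) = E ⟨v, h1⟩ := Fin.ext h2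
      rw [this, Equiv.symm_apply_apply]
    · obtain ⟨r, rfl⟩ := hke
      omega
  have heJ : ∀ x < j - 1, e x ∈ J := fun x hx => Finset.mem_of_mem_erase (he x hx).1
  obtain ⟨F, f1, f2, f3, f4, f5⟩ := LF.core ctx G
    (fun u hu v hv huv => hclique u ((hJB u).2 hu) v ((hJB v).2 hv) huv)
    (fun x hx => by rw [← hbn]; exact hdeg _ (heJ x hx))
    (by
      intro x hx y hy hxy
      have hne : e x ≠ e y := by
        intro hh
        apply hxy
        rw [← (he x hx).2, hh, (he y hy).2]
      refine le_trans (hpair _ (heJ x hx) _ (heJ y hy) hne) ?_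
      rw [← Set.ncard_coe_finset]
      apply Set.ncard_le_ncard _ (Set.toFinite _)
      rintro w ⟨⟨hw, hwB⟩, -⟩
      simp only [LF.bn, Finset.coe_union, Set.mem_union, Finset.mem_coe, Finset.mem_filter] at hw hwB ⊢
      rcases hw with hw | hw
      · exact Or.inl ⟨hwB, hw⟩
      · exact Or.inr ⟨hwB, hw⟩)
    (by rw [← hbn]; exact hp)
  refine ⟨fun i => F i, fun i => f1 i i.2, fun i => f2 i i.2, ?_, ?_, ?_⟩
  · intro i i' hne
    rw [Set.disjoint_left]
    intro ed
    induction ed using Sym2.ind with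
    | _ u v =>
      intro h1 h2
      rw [SimpleGraph.mem_edgeSet] at h1 h2
      exact f3 i i.2 i' i'.2 (fun hh => hne (Fin.ext hh)) u v h1 h2
  · intro u hu v hv huv
    obtain ⟨i, hi, ha⟩ := f4 u ((hJB u).1 hu) v ((hJB v).1 hv) huv
    exact ⟨⟨i, hi⟩, ha⟩
  · intro i v hv
    exact f5 i i.2 v ((hJB v).1 hv)
end

section
/- Let k ≥ 1 be odd, 1 ≤ j ≤ k, ℓ = k − j + 1. Let G be a graph on vertex set J ∪ B with |J| = j, consisting of a clique on J together with a bipartite graph H with parts J and B, such that (i) every v ∈ J has degree at least ℓ in H, with some apex vertex of degree at least ℓ+1 in H; and (ii) for every pair of distinct v, v' ∈ J, |N_H({v,v'}) \ {v,v'}| ≥ ℓ+1. Then G contains (k−1)/2 pairwise edge-disjoint linear forests and one matching, all pairwise edge-disjoint, which together contain all edges of the clique on J, such that every vertex of J has degree exactly 2 in each linear forest and degree exactly 1 in the matching. -/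
namespace PackLF

/-- linear forest certificate: an injective placement on the integers with edges consecutive -/
def Lin {V : Type*} (F : SimpleGraph V) : Prop :=
  ∃ p : V → ℤ, Function.Injective p ∧ ∀ u v, F.Adj u v → p v = p u + 1 ∨ p u = p v + 1

/-- matching -/
def Mat {V : Type*} (F : SimpleGraph V) : Prop :=
  ∀ v x y, F.Adj v x → F.Adj v y → x = y

theorem Lin.acyclic {V : Type*} {F : SimpleGraph V} (h : Lin F) : F.IsAcyclic := by
  obtain ⟨p, hp, hF⟩ := h
  rw [SimpleGraph.isAcyclic_iff_forall_adj_isBridge]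
  have key : ∀ u v, F.Adj u v → p v = p u + 1 → ¬ (F.deleteEdges {s(u, v)}).Reachable u v := by
    intro u v huv hpv hr
    obtain ⟨w⟩ := hr
    have : ∀ a c, (F.deleteEdges {s(u, v)}).Walk a c → p a ≤ p u → p c ≤ p u := by
      intro a c w
      induction w with
      | nil => exact id
      | @cons a d c hadj w ih =>
        intro ha
        apply ih
        rw [SimpleGraph.deleteEdges_adj] at hadj
        obtain ⟨h1, h2⟩ := hadj
        by_contra hcon
        have h3 := hF _ _ h1
        have h4 : p a = p u := by omega
        have h5 : p d = p v := by omega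
        have := hp h4
        have := hp h5
        subst_vars
        simp at h2
    have := this u v w le_rfl
    omega
  intro u v huv
  rw [SimpleGraph.isBridge_iff]
  rcases hF _ _ huv with h | h
  · exact key u v huv h
  · intro hr
    apply key v u huv.symm h
    rw [Sym2.eq_swap]
    exact hr.symm

theorem Lin.deg {V : Type*} {F : SimpleGraph V} (h : Lin F) (v : V) :
    (F.neighborSet v).ncard ≤ 2 := by
  obtain ⟨p, hp, hF⟩ := h
  rw [← Set.ncard_image_of_injective _ hp]
  calc _ ≤ ({p v + 1, p v - 1} : Set ℤ).ncard := by
        apply Set.ncard_le_ncard _ (by simp)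
        rintro _ ⟨x, hx, rfl⟩
        have := hF _ _ hx
        simp only [Set.mem_insert_iff, Set.mem_singleton_iff]
        omega
    _ ≤ 2 := (Set.ncard_insert_le _ _).trans (by simp)

theorem Mat.deg {V : Type*} [Finite V] {F : SimpleGraph V} (h : Mat F) (v : V) :
    (F.neighborSet v).ncard ≤ 1 := by
  rw [Set.ncard_le_one_iff]
  intro a b ha hb
  exact h v a b ha hb

/-- local transposition -/
noncomputable def tau {V : Type*} [DecidableEq V] (W : Set V) (b b' w : V) : Equiv.Perm V :=
  open Classical in if w ∈ W then Equiv.swap b b' else 1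

/-- switch two vertices at all vertices of a set -/
noncomputable def swapG {V : Type*} [DecidableEq V] (F : SimpleGraph V) (W : Set V) (b b' : V) :
    SimpleGraph V where
  Adj u v := F.Adj (tau W b b' v u) (tau W b b' u v)
  symm := ⟨fun _ _ h => SimpleGraph.Adj.symm h⟩
  loopless := ⟨fun _ h => F.irrefl h⟩

theorem tau_pos {V : Type*} [DecidableEq V] {W : Set V} {b b' w : V} (h : w ∈ W) :
    tau W b b' w = Equiv.swap b b' := by simp [tau, h]

theorem tau_neg {V : Type*} [DecidableEq V] {W : Set V} {b b' w : V} (h : w ∉ W) (x : V) :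
    tau W b b' w x = x := by simp [tau, h]

theorem tau_ne {V : Type*} [DecidableEq V] {W : Set V} {b b' w x : V} (h : x ≠ b) (h' : x ≠ b') :
    tau W b b' w x = x := by
  by_cases hw : w ∈ W
  · rw [tau_pos hw, Equiv.swap_apply_of_ne_of_ne h h']
  · exact tau_neg hw x

theorem swapG_comm {V : Type*} [DecidableEq V] (F : SimpleGraph V) (W : Set V) (b b' : V) :
    swapG F W b b' = swapG F W b' b := by
  have : tau W b b' = tau W b' b := by
    funext w; simp [tau, Equiv.swap_comm]
  ext u v
  simp [swapG, this]

theorem swapG_adj {V : Type*} [DecidableEq V] {F : SimpleGraph V} {W : Set V} {b b' : V}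
    (hb : b ∉ W) (hb' : b' ∉ W) (hne : b ≠ b') (hF : ¬ F.Adj b b') {u v : V}
    (h : (swapG F W b b').Adj u v) :
    (u ≠ b ∧ u ≠ b' ∧ v ≠ b ∧ v ≠ b' ∧ F.Adj u v) ∨
    (∃ x, x ≠ b ∧ x ≠ b' ∧ ((u = x ∧ v = b) ∨ (u = b ∧ v = x)) ∧
      ((x ∈ W ∧ F.Adj x b') ∨ (x ∉ W ∧ F.Adj x b))) ∨
    (∃ x, x ≠ b ∧ x ≠ b' ∧ ((u = x ∧ v = b') ∨ (u = b' ∧ v = x)) ∧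
      ((x ∈ W ∧ F.Adj x b) ∨ (x ∉ W ∧ F.Adj x b'))) := by
  have hF' : ¬ F.Adj b' b := fun h => hF h.symm
  change F.Adj (tau W b b' v u) (tau W b b' u v) at h
  by_cases hu : u = b
  · subst hu
    rw [tau_neg hb] at h
    by_cases hv : v ∈ W
    · rw [tau_pos hv, Equiv.swap_apply_left] at h
      right; left
      exact ⟨v, by grind, by grind, by grind, .inl ⟨hv, h.symm⟩⟩
    · rw [tau_neg hv] at h
      right; left
      exact ⟨v, h.ne', by grind, by grind, .inr ⟨hv, h.symm⟩⟩
  by_cases hu' : u = b'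
  · subst hu'
    rw [tau_neg hb'] at h
    by_cases hv : v ∈ W
    · rw [tau_pos hv, Equiv.swap_apply_right] at h
      right; right
      exact ⟨v, by grind, by grind, by grind, .inl ⟨hv, h.symm⟩⟩
    · rw [tau_neg hv] at h
      right; right
      exact ⟨v, by grind, h.ne', by grind, .inr ⟨hv, h.symm⟩⟩
  rw [tau_ne hu hu'] at h
  by_cases hv : v = b
  · subst hv
    right; left
    refine ⟨u, hu, hu', by grind, ?_⟩
    by_cases hw : u ∈ W
    · rw [tau_pos hw, Equiv.swap_apply_left] at h; exact .inl ⟨hw, h⟩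
    · rw [tau_neg hw] at h; exact .inr ⟨hw, h⟩
  by_cases hv' : v = b'
  · subst hv'
    right; right
    refine ⟨u, hu, hu', by grind, ?_⟩
    by_cases hw : u ∈ W
    · rw [tau_pos hw, Equiv.swap_apply_right] at h; exact .inl ⟨hw, h⟩
    · rw [tau_neg hw] at h; exact .inr ⟨hw, h⟩
  rw [tau_ne hv hv'] at h
  exact .inl ⟨hu, hu', hv, hv', h⟩

theorem lin_swap_aux {V : Type*} [DecidableEq V] {F : SimpleGraph V} {W : Set V} {b b' : V}
    (hb : b ∉ W) (hb' : b' ∉ W) (hne : b ≠ b') (hF : ¬ F.Adj b b')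
    (p : V → ℤ) (hp : Function.Injective p)
    (hpF : ∀ u v, F.Adj u v → p v = p u + 1 ∨ p u = p v + 1)
    (hlt : p b < p b')
    (hW : ∀ x y, F.Adj x b → F.Adj y b' → p x + p y = p b + p b' → (x ∈ W ↔ y ∈ W)) :
    Lin (swapG F W b b') := by
  have hinn : ∃ inn : Bool, ∀ v, ((F.Adj v b ∧ p v = p b + 1) ∨ (F.Adj v b' ∧ p v = p b' - 1)) →
      (v ∈ W ↔ inn = true) := by
    by_cases h : ∃ v, ((F.Adj v b ∧ p v = p b + 1) ∨ (F.Adj v b' ∧ p v = p b' - 1)) ∧ v ∈ W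
    · refine ⟨true, fun y hy => ?_⟩
      obtain ⟨x, hx, hxW⟩ := h
      simp only [iff_true]
      rcases hx with hx | hx <;> rcases hy with hy | hy
      · have : x = y := hp (by omega)
        exact this ▸ hxW
      · exact (hW x y hx.1 hy.1 (by omega)).1 hxW
      · exact (hW y x hy.1 hx.1 (by omega)).2 hxW
      · have : x = y := hp (by omega)
        exact this ▸ hxW
    · refine ⟨false, fun y hy => ?_⟩
      simp only [Bool.false_eq_true, iff_false]
      exact fun hyW => h ⟨y, hy, hyW⟩
  have hout : ∃ out : Bool, ∀ v, ((F.Adj v b ∧ p v = p b - 1) ∨ (F.Adj v b' ∧ p v = p b' + 1)) →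
      (v ∈ W ↔ out = true) := by
    by_cases h : ∃ v, ((F.Adj v b ∧ p v = p b - 1) ∨ (F.Adj v b' ∧ p v = p b' + 1)) ∧ v ∈ W
    · refine ⟨true, fun y hy => ?_⟩
      obtain ⟨x, hx, hxW⟩ := h
      simp only [iff_true]
      rcases hx with hx | hx <;> rcases hy with hy | hy
      · have : x = y := hp (by omega)
        exact this ▸ hxW
      · exact (hW x y hx.1 hy.1 (by omega)).1 hxW
      · exact (hW y x hy.1 hx.1 (by omega)).2 hxW
      · have : x = y := hp (by omega)
        exact this ▸ hxW
    · refine ⟨false, fun y hy => ?_⟩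
      simp only [Bool.false_eq_true, iff_false]
      exact fun hyW => h ⟨y, hy, hyW⟩
  obtain ⟨inn, hinn⟩ := hinn
  obtain ⟨out, hout⟩ := hout
  let R : ℤ → ℤ := fun z =>
    if inn = out then z else if p b < z ∧ z < p b' then p b + p b' - z else z
  have hR : Function.Injective R := by
    intro x y h
    simp only [R] at h
    split_ifs at h <;> omega
  let t : Equiv.Perm V := if out = true then Equiv.swap b b' else 1
  refine ⟨fun v => R (p (t v)), hR.comp (hp.comp t.injective), ?_⟩
  have ht : ∀ x, x ≠ b → x ≠ b' → t x = x := by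
    intro x h1 h2
    simp only [t]
    split_ifs
    · exact Equiv.swap_apply_of_ne_of_ne h1 h2
    · rfl
  have htb : t b = if out = true then b' else b := by
    simp only [t]; split_ifs <;> simp
  have htb' : t b' = if out = true then b else b' := by
    simp only [t]; split_ifs <;> simp
  intro u v huv
  have main1 : ∀ x, x ≠ b → x ≠ b' → ((x ∈ W ∧ F.Adj x b') ∨ (x ∉ W ∧ F.Adj x b)) →
      R (p (t b)) = R (p (t x)) + 1 ∨ R (p (t x)) = R (p (t b)) + 1 := by
    intro x h1 h2 h
    rw [ht x h1 h2, htb]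
    have e1 : p x ≠ p b := fun h => h1 (hp h)
    have e2 : p x ≠ p b' := fun h => h2 (hp h)
    have i1 := hinn x
    have i2 := hout x
    rcases h with ⟨hw, ha⟩ | ⟨hw, ha⟩
    · have := hpF _ _ ha
      simp only [ha, hw, true_and, true_iff] at i1 i2
      simp only [R]
      cases inn <;> cases out <;> simp at i1 i2 ⊢ <;> (try split_ifs) <;> omega
    · have := hpF _ _ ha
      simp only [ha, hw, true_and, false_iff] at i1 i2
      simp only [R]
      cases inn <;> cases out <;> simp at i1 i2 ⊢ <;> (try split_ifs) <;> omega
  have main2 : ∀ x, x ≠ b → x ≠ b' → ((x ∈ W ∧ F.Adj x b) ∨ (x ∉ W ∧ F.Adj x b')) →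
      R (p (t b')) = R (p (t x)) + 1 ∨ R (p (t x)) = R (p (t b')) + 1 := by
    intro x h1 h2 h
    rw [ht x h1 h2, htb']
    have e1 : p x ≠ p b := fun h => h1 (hp h)
    have e2 : p x ≠ p b' := fun h => h2 (hp h)
    have i1 := hinn x
    have i2 := hout x
    rcases h with ⟨hw, ha⟩ | ⟨hw, ha⟩
    · have := hpF _ _ ha
      simp only [ha, hw, true_and, true_iff] at i1 i2
      simp only [R]
      cases inn <;> cases out <;> simp at i1 i2 ⊢ <;> (try split_ifs) <;> omega
    · have := hpF _ _ ha
      simp only [ha, hw, true_and, false_iff] at i1 i2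
      simp only [R]
      cases inn <;> cases out <;> simp at i1 i2 ⊢ <;> (try split_ifs) <;> omega
  rcases swapG_adj hb hb' hne hF huv with ⟨h1, h2, h3, h4, h⟩ | ⟨x, h1, h2, h, h'⟩ | ⟨x, h1, h2, h, h'⟩
  · simp only
    rw [ht u h1 h2, ht v h3 h4]
    have e1 : p u ≠ p b := fun h => h1 (hp h)
    have e2 : p u ≠ p b' := fun h => h2 (hp h)
    have e3 : p v ≠ p b := fun h => h3 (hp h)
    have e4 : p v ≠ p b' := fun h => h4 (hp h)
    have := hpF _ _ h
    simp only [R]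
    split_ifs <;> omega
  · have := main1 x h1 h2 h'
    rcases h with ⟨rfl, rfl⟩ | ⟨rfl, rfl⟩
    · exact this
    · exact this.symm
  · have := main2 x h1 h2 h'
    rcases h with ⟨rfl, rfl⟩ | ⟨rfl, rfl⟩
    · exact this
    · exact this.symm

theorem lin_swap {V : Type*} [DecidableEq V] {F : SimpleGraph V} {b b' : V}
    (hne : b ≠ b') (hF : ¬ F.Adj b b') (h : Lin F) :
    ∃ π : V → V → Prop, (∀ x y, π x y → F.Adj x b ∧ F.Adj y b') ∧
      (∀ x y z, π x y → π x z → y = z) ∧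
      ∀ W : Set V, b ∉ W → b' ∉ W → (∀ x y, π x y → (x ∈ W ↔ y ∈ W)) → Lin (swapG F W b b') := by
  obtain ⟨p, hp, hpF⟩ := h
  refine ⟨fun x y => F.Adj x b ∧ F.Adj y b' ∧ p x + p y = p b + p b', fun x y h => ⟨h.1, h.2.1⟩,
    fun x y z h1 h2 => hp (by omega), ?_⟩
  intro W hb hb' hW
  rcases lt_or_gt_of_ne (fun h => hne (hp h) : p b ≠ p b') with hlt | hlt
  · exact lin_swap_aux hb hb' hne hF p hp hpF hlt fun x y h1 h2 h3 => hW x y ⟨h1, h2, h3⟩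
  · rw [swapG_comm]
    exact lin_swap_aux hb' hb hne.symm (fun h => hF h.symm) p hp hpF hlt
      fun x y h1 h2 h3 => (hW y x ⟨h2, h1, by omega⟩).symm

theorem mat_swap {V : Type*} [DecidableEq V] {F : SimpleGraph V} {b b' : V}
    (hne : b ≠ b') (hF : ¬ F.Adj b b') (h : Mat F) :
    ∃ π : V → V → Prop, (∀ x y, π x y → F.Adj x b ∧ F.Adj y b') ∧
      (∀ x y z, π x y → π x z → y = z) ∧
      ∀ W : Set V, b ∉ W → b' ∉ W → (∀ x y, π x y → (x ∈ W ↔ y ∈ W)) → Mat (swapG F W b b') := by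
  refine ⟨fun x y => F.Adj x b ∧ F.Adj y b', fun x y h => h,
    fun x y z h1 h2 => h b' y z h1.2.symm h2.2.symm, ?_⟩
  intro W hb hb' hW v x y hx hy
  have c1 : ∀ x y, F.Adj x b → F.Adj y b → x = y := fun x y hx hy => h b x y hx.symm hy.symm
  have c2 : ∀ x y, F.Adj x b' → F.Adj y b' → x = y := fun x y hx hy => h b' x y hx.symm hy.symm
  have c3 : ∀ x, F.Adj x b → ¬ F.Adj x b' := fun x hx hy => hne (h x b b' hx hy)
  have c4 := fun x hx y => h x b y hx
  have c5 := fun x hx y => h x b' y hx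
  rcases swapG_adj hb hb' hne hF hx with ⟨h1, h2, h3, h4, h5⟩ | ⟨x1, h1, h2, h3, h4⟩ | ⟨x1, h1, h2, h3, h4⟩ <;>
  rcases swapG_adj hb hb' hne hF hy with ⟨g1, g2, g3, g4, g5⟩ | ⟨y1, g1, g2, g3, g4⟩ | ⟨y1, g1, g2, g3, g4⟩
  · exact h v x y h5 g5
  all_goals grind


/-- A packing in which `v ∈ J` may only use vertices outside `J` from the list `N v`. -/
structure Sol {V : Type*} (J : Finset V) (N : V → Finset V) {m : ℕ}
    (F : Option (Fin m) → SimpleGraph V) : Prop where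
  lin : ∀ i, Lin (F (some i))
  mat : Mat (F none)
  disj : ∀ i i' u v, (F i).Adj u v → (F i').Adj u v → i = i'
  cov : ∀ u ∈ J, ∀ v ∈ J, u ≠ v → ∃ i, (F i).Adj u v
  inJ : ∀ i u v, (F i).Adj u v → u ∈ J ∨ v ∈ J
  lst : ∀ i u v, (F i).Adj u v → u ∈ J → v ∉ J → v ∈ N u
  deg2 : ∀ i, ∀ v ∈ J, ((F (some i)).neighborSet v).ncard = 2
  deg1 : ∀ v ∈ J, ((F none).neighborSet v).ncard = 1

/-- transposed list -/
def tw {V : Type*} [DecidableEq V] (b b' : V) (X : Finset V) : Finset V :=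
  X.image (Equiv.swap b b')

theorem mem_tw {V : Type*} [DecidableEq V] {b b' x : V} {X : Finset V} :
    x ∈ tw b b' X ↔ Equiv.swap b b' x ∈ X := by
  simp only [tw, Finset.mem_image]
  constructor
  · rintro ⟨y, hy, rfl⟩; simpa using hy
  · intro h; exact ⟨_, h, by simp⟩

theorem tw_tw {V : Type*} [DecidableEq V] {b b' : V} {X : Finset V} :
    tw b b' (tw b b' X) = X := by
  ext x; simp [mem_tw]

theorem tw_self {V : Type*} [DecidableEq V] {b b' : V} {X : Finset V} (h : b ∈ X ↔ b' ∈ X) :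
    tw b b' X = X := by
  ext x
  rw [mem_tw, Equiv.swap_apply_def]
  split_ifs with h1 h2
  · subst h1; exact h.symm
  · subst h2; exact h
  · rfl

theorem left_mem_tw {V : Type*} [DecidableEq V] {b b' : V} {X : Finset V} :
    b ∈ tw b b' X ↔ b' ∈ X := by simp [mem_tw]

theorem right_mem_tw {V : Type*} [DecidableEq V] {b b' : V} {X : Finset V} :
    b' ∈ tw b b' X ↔ b ∈ X := by simp [mem_tw]

theorem card_tw {V : Type*} [DecidableEq V] {b b' : V} {X : Finset V} :
    (tw b b' X).card = X.card := Finset.card_image_of_injective _ (Equiv.injective _)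

theorem Sol.permute {V : Type*} {J : Finset V} {N N2 : V → Finset V} {m : ℕ}
    {F : Option (Fin m) → SimpleGraph V} (h : Sol J N F) (r : Equiv.Perm V)
    (hrJ : ∀ v, r v ∈ J ↔ v ∈ J) (hr : ∀ v, v ∉ J → r v = v)
    (hN : ∀ v ∈ J, N (r v) ⊆ N2 v) :
    Sol J N2 (fun i => (F i).comap r) where
  lin i := by
    obtain ⟨p, hp, hF⟩ := h.lin i
    exact ⟨p ∘ r, hp.comp r.injective, fun u v huv => hF _ _ huv⟩
  mat v x y hx hy := r.injective (h.mat _ _ _ hx hy)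
  disj i i' u v h1 h2 := h.disj i i' _ _ h1 h2
  cov u hu v hv huv := h.cov _ ((hrJ u).2 hu) _ ((hrJ v).2 hv) (fun e => huv (r.injective e))
  inJ i u v huv := by simpa [hrJ] using h.inJ i _ _ huv
  lst i u v huv hu hv := by
    have := h.lst i _ _ huv ((hrJ u).2 hu) (fun e => hv ((hrJ v).1 e))
    rw [hr v hv] at this
    exact hN u hu this
  deg2 i v hv := by
    rw [← h.deg2 i _ ((hrJ v).2 hv), ← Set.ncard_image_of_injective _ r.injective]
    congr 1
    ext x
    constructor
    · rintro ⟨y, hy, rfl⟩; exact hy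
    · intro hx; exact ⟨r.symm x, by simpa using hx, by simp⟩
  deg1 v hv := by
    rw [← h.deg1 _ ((hrJ v).2 hv), ← Set.ncard_image_of_injective _ r.injective]
    congr 1
    ext x
    constructor
    · rintro ⟨y, hy, rfl⟩; exact hy
    · intro hx; exact ⟨r.symm x, by simpa using hx, by simp⟩

open Classical in
theorem Sol.swap {V : Type*} [DecidableEq V] {J : Finset V} {N : V → Finset V} {m : ℕ}
    {F : Option (Fin m) → SimpleGraph V} (h : Sol J N F) {b b' : V} (hb : b ∉ J) (hb' : b' ∉ J)
    {W : Set V}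
    (hlin : ∀ i, Lin (swapG (F (some i)) W b b')) (hmat : Mat (swapG (F none) W b b')) :
    Sol J (fun v => if v ∈ W then tw b b' (N v) else N v) (fun i => swapG (F i) W b b') := by
  have hJ : ∀ v ∈ J, ∀ w, tau W b b' w v = v := fun v hv w =>
    tau_ne (fun e => hb (e ▸ hv)) (fun e => hb' (e ▸ hv))
  have hJa : ∀ i, ∀ v ∈ J, ∀ x, (swapG (F i) W b b').Adj v x ↔ (F i).Adj v (tau W b b' v x) := by
    intro i v hv x
    change (F i).Adj _ _ ↔ _
    rw [hJ v hv]
  have hnb : ∀ i, ∀ v ∈ J, ((swapG (F i) W b b').neighborSet v).ncard =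
      ((F i).neighborSet v).ncard := by
    intro i v hv
    rw [← Set.ncard_image_of_injective _ (tau W b b' v).injective]
    congr 1
    ext x
    constructor
    · rintro ⟨y, hy, rfl⟩; exact (hJa i v hv y).1 hy
    · intro hx; exact ⟨(tau W b b' v).symm x, (hJa i v hv _).2 (by simpa using hx), by simp⟩
  have htJ : ∀ w x, tau W b b' w x ∈ J ↔ x ∈ J := by
    intro w x
    by_cases hx : x ∈ J
    · rw [hJ x hx]
    · simp only [hx, iff_false]
      intro hc
      have := hJ _ hc w
      have := (tau W b b' w).injective this
      rw [this] at hc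
      exact hx hc
  refine ⟨hlin, hmat, fun i i' u v h1 h2 => h.disj i i' _ _ h1 h2, ?_, ?_, ?_, ?_, ?_⟩
  · intro u hu v hv huv
    obtain ⟨i, hi⟩ := h.cov u hu v hv huv
    exact ⟨i, (hJa i u hu v).2 (by rwa [hJ v hv])⟩
  · intro i u v huv
    simpa [htJ] using h.inJ i _ _ huv
  · intro i u v huv hu hv
    have := h.lst i _ _ ((hJa i u hu v).1 huv) hu (by rwa [htJ])
    split_ifs with hW
    · rw [mem_tw]; rwa [tau_pos hW] at this
    · rwa [tau_neg hW] at this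
  · intro i v hv; rw [hnb _ v hv, h.deg2 i v hv]
  · intro v hv; rw [hnb _ v hv, h.deg1 v hv]

open Classical in
/-- The compression step. -/
theorem kempe {V : Type*} [DecidableEq V] {J : Finset V} {N : V → Finset V} {m : ℕ}
    (σ : V → V) (hσ : ∀ v, σ (σ v) = v) (hσJ : ∀ v ∈ J, σ v ∈ J) (hσo : ∀ v, v ∉ J → σ v = v)
    {b b' : V} (hb : b ∉ J) (hb' : b' ∉ J) (hne : b ≠ b')
    (F : Option (Fin m) → SimpleGraph V)
    (h : Sol J (fun v => if b ∈ N v ∧ b' ∉ N v ∧ N (σ v) ≠ tw b b' (N v) then tw b b' (N v)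
      else N v) F) :
    ∃ F' : Option (Fin m) → SimpleGraph V, Sol J N F' := by
  set A : V → Prop := fun v => b ∈ N v ∧ b' ∉ N v ∧ N (σ v) ≠ tw b b' (N v) with hA
  set E : V → Prop := fun v => b ∈ N v ∧ b' ∉ N v ∧ N (σ v) = tw b b' (N v) with hE
  set N' : V → Finset V := fun v => if A v then tw b b' (N v) else N v with hN'
  have hbb : ∀ i, ¬ (F i).Adj b b' := fun i hc => (h.inJ i _ _ hc).elim hb hb'
  have hpi : ∀ i, ∃ π : V → V → Prop, (∀ x y, π x y → (F i).Adj x b ∧ (F i).Adj y b') ∧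
      (∀ x y z, π x y → π x z → y = z) ∧
      ∀ W : Set V, b ∉ W → b' ∉ W → (∀ x y, π x y → (x ∈ W ↔ y ∈ W)) →
        (match i with
          | none => Mat (swapG (F i) W b b')
          | some _ => Lin (swapG (F i) W b b')) := by
    intro i
    cases i with
    | none => exact mat_swap hne (hbb _) h.mat
    | some i => exact lin_swap hne (hbb _) (h.lin i)
  choose π hπ1 hπ2 hπ3 using hpi
  have hEA : ∀ v, E v → ¬ A v := fun v h1 h2 => h2.2.2 h1.2.2
  have hEs : ∀ v, E v → ¬ E (σ v) := by
    intro v h1 h2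
    have : b ∈ N (σ v) := h2.1
    rw [h1.2.2, left_mem_tw] at this
    exact h1.2.1 this
  have hEs' : ∀ v, E v → ¬ A (σ v) := by
    intro v h1 h2
    have : b ∈ N (σ v) := h2.1
    rw [h1.2.2, left_mem_tw] at this
    exact h1.2.1 this
  let e : V → V := fun v => if E (σ v) then σ v else v
  have he1 : ∀ v, E v → e v = v := fun v hv => by simp [e, hEs v hv]
  have he2 : ∀ v, E v → e (σ v) = v := fun v hv => by simp [e, hσ, hv]
  let f : V → V := fun v => if hv : ∃ y i, π i (e v) y then hv.choose else e v
  have hf : ∀ i x y, π i x y → f x = y := by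
    intro i x y hxy
    have hx1 := (hπ1 i x y hxy).1
    have hxJ : x ∈ J := (h.inJ i _ _ hx1).resolve_right hb
    have hxb := h.lst i _ _ hx1 hxJ hb
    have hnA : ¬ A x := by
      intro hAx
      simp only [hN', hAx, if_true, left_mem_tw] at hxb
      exact hAx.2.1 hxb
    simp only [hN', hnA, if_false] at hxb
    have hex : e x = x := by
      simp only [e]
      rw [if_neg]
      intro hc
      have h2 := hc.2.2
      rw [hσ] at h2
      rw [h2, left_mem_tw] at hxb
      exact hc.2.1 hxb
    have hv : ∃ y i, π i (e x) y := ⟨y, i, by rwa [hex]⟩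
    have : f x = hv.choose := by simp only [f]; rw [dif_pos hv]
    rw [this]
    obtain ⟨i', hi'⟩ := hv.choose_spec
    revert hi'
    generalize hv.choose = z
    intro hi'
    rw [hex] at hi'
    have := h.disj i i' _ _ hx1 (hπ1 i' _ _ hi').1
    subst this
    exact hπ2 i x _ _ hi' hxy
  have hnotA : ∀ i x y, π i x y → ¬ A x := by
    intro i x y hxy hAx
    have hx1 := (hπ1 i x y hxy).1
    have hxJ : x ∈ J := (h.inJ i _ _ hx1).resolve_right hb
    have hxb := h.lst i _ _ hx1 hxJ hb
    simp only [hN', hAx, if_true, left_mem_tw] at hxb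
    exact hAx.2.1 hxb
  let W : Set V := {v | v ∈ J ∧ ∃ n, A (f^[n] v)}
  have hWπ : ∀ i x y, π i x y → (x ∈ W ↔ y ∈ W) := by
    intro i x y hxy
    have hxJ : x ∈ J := (h.inJ i _ _ (hπ1 i x y hxy).1).resolve_right hb
    have hyJ : y ∈ J := (h.inJ i _ _ (hπ1 i x y hxy).2).resolve_right hb'
    have hfx := hf i x y hxy
    constructor
    · rintro ⟨-, n, hn⟩
      cases n with
      | zero => exact absurd hn (hnotA i x y hxy)
      | succ n =>
        rw [Function.iterate_succ_apply, hfx] at hn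
        exact ⟨hyJ, n, hn⟩
    · rintro ⟨-, n, hn⟩
      refine ⟨hxJ, n + 1, ?_⟩
      rw [Function.iterate_succ_apply, hfx]
      exact hn
  have hWE : ∀ v, E v → (v ∈ W ↔ σ v ∈ W) := by
    intro v hv
    have hff : f v = f (σ v) := by
      have : e v = e (σ v) := by rw [he1 v hv, he2 v hv]
      simp only [f, this]
    have hJv : v ∈ J ↔ σ v ∈ J := ⟨hσJ v, fun h1 => by simpa [hσ] using hσJ _ h1⟩
    constructor
    · rintro ⟨h1, n, hn⟩
      refine ⟨hJv.1 h1, ?_⟩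
      cases n with
      | zero => exact absurd hn (hEA v hv)
      | succ n => exact ⟨n + 1, by rw [Function.iterate_succ_apply, ← hff]; exact hn⟩
    · rintro ⟨h1, n, hn⟩
      refine ⟨hJv.2 h1, ?_⟩
      cases n with
      | zero => exact absurd hn (hEs' v hv)
      | succ n => exact ⟨n + 1, by rw [Function.iterate_succ_apply, hff]; exact hn⟩
  have hS := h.swap hb hb' (W := W)
    (fun i => hπ3 (some i) W (fun hc => hb hc.1) (fun hc => hb' hc.1) (hWπ (some i)))
    (hπ3 none W (fun hc => hb hc.1) (fun hc => hb' hc.1) (hWπ none))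
  let r0 : V → V := fun v => if v ∈ W ∧ (E v ∨ E (σ v)) then σ v else v
  have hr0 : Function.Involutive r0 := by
    intro v
    by_cases hv : v ∈ W ∧ (E v ∨ E (σ v))
    · have hv' : σ v ∈ W ∧ (E (σ v) ∨ E (σ (σ v))) := by
        rw [hσ]
        refine ⟨?_, hv.2.symm⟩
        rcases hv.2 with h1 | h1
        · exact (hWE v h1).1 hv.1
        · have := hWE _ h1
          rw [hσ] at this
          exact this.2 hv.1
      simp only [r0]
      rw [if_pos hv, if_pos hv', hσ]
    · simp only [r0]
      rw [if_neg hv, if_neg hv]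
  have hrJ : ∀ v, v ∈ J → r0 v ∈ J := by
    intro v hv
    simp only [r0]
    split_ifs
    · exact hσJ v hv
    · exact hv
  refine ⟨_, hS.permute hr0.toPerm ?_ ?_ ?_⟩
  · intro v
    exact ⟨fun hv => by simpa [hr0 v] using hrJ _ hv, hrJ v⟩
  · intro v hv
    change r0 v = v
    simp only [r0]
    split_ifs
    · exact hσo v hv
    · rfl
  · intro v hvJ
    simp only [Function.Involutive.coe_toPerm]
    by_cases hv : v ∈ W ∧ (E v ∨ E (σ v))
    · have hr : r0 v = σ v := by simp only [r0]; rw [if_pos hv]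
      simp only [hr]
      rcases hv.2 with h1 | h1
      · rw [if_pos ((hWE v h1).1 hv.1)]
        simp only [hN', hEs' v h1, if_false]
        rw [h1.2.2, tw_tw]
      · have h3 := hWE _ h1
        rw [hσ] at h3
        rw [if_pos (h3.2 hv.1)]
        simp only [hN', hEA _ h1, if_false]
        have := h1.2.2
        rw [hσ] at this
        rw [this]
    · have hr : r0 v = v := by simp only [r0]; rw [if_neg hv]
      simp only [hr]
      by_cases hvW : v ∈ W
      · rw [if_pos hvW]
        have hv2 : ¬ E v ∧ ¬ E (σ v) := by
          constructor
          · exact fun hc => hv ⟨hvW, .inl hc⟩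
          · exact fun hc => hv ⟨hvW, .inr hc⟩
        by_cases hAv : A v
        · simp only [hN', hAv, if_true]
          rw [tw_tw]
        · simp only [hN', hAv, if_false]
          rw [tw_self]
          constructor
          · intro h1
            by_contra h2
            by_cases h3 : N (σ v) = tw b b' (N v)
            · exact hv2.1 ⟨h1, h2, h3⟩
            · exact hAv ⟨h1, h2, h3⟩
          · intro h1
            by_contra h2
            have hev : e v = v := by simp only [e]; rw [if_neg hv2.2]
            have hfv : f v = v := by
              have : ¬ ∃ y i, π i (e v) y := by
                rintro ⟨y, i, hy⟩
                rw [hev] at hy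
                have := h.lst i _ _ (hπ1 i _ _ hy).1 hvJ hb
                simp only [hN', hAv, if_false] at this
                exact h2 this
              simp only [f]
              rw [dif_neg this, hev]
            obtain ⟨-, n, hn⟩ := hvW
            rw [Function.iterate_fixed hfv] at hn
            exact hAv hn
      · rw [if_neg hvW]
        have hAv : ¬ A v := fun hc => hvW ⟨hvJ, 0, hc⟩
        simp only [hN', hAv, if_false]
        exact fun x hx => hx



open Classical in
theorem compress {V : Type*} [DecidableEq V] {J B T : Finset V} {m : ℕ}
    (σ : V → V) (hσ : ∀ v, σ (σ v) = v) (hσJ : ∀ v ∈ J, σ v ∈ J) (hσo : ∀ v, v ∉ J → σ v = v)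
    (hJB : Disjoint J B) (hT : T ⊆ B) {p : V} (hp : p ∈ T)
    (base : ∀ N : V → Finset V, (∀ v ∈ J, N v = T ∨ ∃ b ∈ B, b ∉ T ∧ N v = insert b (T.erase p) ∧
      N (σ v) = T ∧ σ v ≠ v) → (∀ v ∈ J, σ v ≠ v → N (σ v) ≠ N v) →
      ∃ F : Option (Fin m) → SimpleGraph V, Sol J N F)
    (N : V → Finset V) (hNB : ∀ v ∈ J, N v ⊆ B) (hNc : ∀ v ∈ J, (N v).card = T.card)
    (hNp : ∀ v ∈ J, σ v ≠ v → N (σ v) ≠ N v) :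
    ∃ F : Option (Fin m) → SimpleGraph V, Sol J N F := by
  set rk : V → ℕ := fun x => if x ∈ T then (if x = p then 1 else 0) else 2 with hrk
  induction hn : ∑ v ∈ J, ∑ x ∈ N v, rk x using Nat.strong_induction_on generalizing N with
  | _ n ih =>
  by_cases hmove : ∃ b ∈ B, ∃ b' ∈ B, rk b' < rk b ∧ ∃ v ∈ J, b ∈ N v ∧ b' ∉ N v ∧
      N (σ v) ≠ tw b b' (N v)
  · obtain ⟨b, hbB, b', hbB', hlt, v0, hv0, hA0⟩ := hmove
    have hb : b ∉ J := fun hc => Finset.disjoint_left.1 hJB hc hbB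
    have hb' : b' ∉ J := fun hc => Finset.disjoint_left.1 hJB hc hbB'
    have hne : b ≠ b' := by rintro rfl; exact lt_irrefl _ hlt
    have hsum : ∀ v, b ∈ N v → b' ∉ N v → ∑ x ∈ tw b b' (N v), rk x < ∑ x ∈ N v, rk x := by
      intro v h1 h2
      rw [tw, Finset.sum_image (fun x _ y _ h => (Equiv.injective _) h)]
      apply Finset.sum_lt_sum
      · intro x hx
        by_cases hxb : x = b
        · subst hxb; rw [Equiv.swap_apply_left]; exact hlt.le
        · rw [Equiv.swap_apply_of_ne_of_ne hxb (by rintro rfl; exact h2 hx)]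
      · exact ⟨b, h1, by rw [Equiv.swap_apply_left]; exact hlt⟩
    have key : ∃ F : Option (Fin m) → SimpleGraph V, Sol J (fun v => if b ∈ N v ∧ b' ∉ N v ∧ N (σ v) ≠ tw b b' (N v)
        then tw b b' (N v) else N v) F := by
      refine ih _ ?_ _ ?_ ?_ ?_ rfl
      · rw [← hn]
        apply Finset.sum_lt_sum
        · intro v _
          split_ifs with h
          · exact (hsum v h.1 h.2.1).le
          · exact le_rfl
        · refine ⟨v0, hv0, ?_⟩
          rw [if_pos hA0]
          exact hsum v0 hA0.1 hA0.2.1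
      · intro v hv
        split_ifs with h
        · intro x hx
          rw [mem_tw, Equiv.swap_apply_def] at hx
          split_ifs at hx with h1 h2
          · exact h1 ▸ hbB
          · exact h2 ▸ hbB'
          · exact hNB v hv hx
        · exact hNB v hv
      · intro v hv
        split_ifs with h
        · rw [card_tw, hNc v hv]
        · exact hNc v hv
      · intro v hv hvs
        by_cases h1 : b ∈ N v ∧ b' ∉ N v ∧ N (σ v) ≠ tw b b' (N v)
        · by_cases h2 : b ∈ N (σ v) ∧ b' ∉ N (σ v) ∧ N (σ (σ v)) ≠ tw b b' (N (σ v))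
          · simp only [if_pos h1, if_pos h2]
            intro hc
            have := congrArg (tw b b') hc
            rw [tw_tw, tw_tw] at this
            exact hNp v hv hvs this
          · simp only [if_pos h1, if_neg h2]
            exact h1.2.2
        · by_cases h2 : b ∈ N (σ v) ∧ b' ∉ N (σ v) ∧ N (σ (σ v)) ≠ tw b b' (N (σ v))
          · simp only [if_neg h1, if_pos h2]
            have := h2.2.2
            rw [hσ] at this
            exact this.symm
          · simp only [if_neg h1, if_neg h2]
            exact hNp v hv hvs
    obtain ⟨F, hF⟩ := key
    exact kempe σ hσ hσJ hσo hb hb' hne F hF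
  · push Not at hmove
    refine base N ?_ hNp
    intro v hv
    by_cases hvT : N v = T
    · exact .inl hvT
    right
    have h1 : ∃ b ∈ N v, b ∉ T := by
      by_contra hc
      push Not at hc
      exact hvT (Finset.eq_of_subset_of_card_le hc (hNc v hv).ge)
    have h2 : ∃ b ∈ T, b ∉ N v := by
      by_contra hc
      push Not at hc
      exact hvT (Finset.eq_of_subset_of_card_le hc (hNc v hv).le).symm
    obtain ⟨b, hbN, hbT⟩ := h1
    obtain ⟨b', hbT', hbN'⟩ := h2
    have hr : ∀ x y, x ∉ T → y ∈ T → rk y < rk x := by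
      intro x y hx hy
      simp only [hrk, hx, hy, if_true, if_false]
      split_ifs <;> omega
    have hmv : ∀ x y, x ∈ N v → x ∉ T → y ∈ T → y ∉ N v → N (σ v) = tw x y (N v) :=
      fun x y hx hx' hy hy' => hmove x (hNB v hv hx) y (hT hy) (hr x y hx' hy) v hv hx hy'
    have h0 := hmv b b' hbN hbT hbT' hbN'
    have hu1 : ∀ x ∈ N v, x ≠ b → x ∈ T := by
      intro x hx hxb
      by_contra hxT
      have h3 := hmv x b' hx hxT hbT' hbN'
      have h4 : b ∉ N (σ v) := by rw [h0, left_mem_tw]; exact hbN'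
      apply h4
      rw [h3, mem_tw, Equiv.swap_apply_of_ne_of_ne hxb.symm]
      · exact hbN
      · rintro rfl; exact hbT hbT'
    have hu2 : ∀ x ∈ T, x ≠ b' → x ∈ N v := by
      intro x hx hxb
      by_contra hxT
      have h3 := hmv b x hbN hbT hx hxT
      have h4 : b' ∈ N (σ v) := by rw [h0, right_mem_tw]; exact hbN
      rw [h3, mem_tw, Equiv.swap_apply_of_ne_of_ne _ hxb.symm] at h4
      · exact hbN' h4
      · rintro rfl; exact hbT hbT'
    have hT' : N (σ v) = T := by
      rw [h0]
      ext x
      rw [mem_tw, Equiv.swap_apply_def]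
      split_ifs with h3 h4
      · subst h3; simp [hbN', hbT]
      · subst h4; simp [hbN, hbT']
      · exact ⟨fun h => hu1 x h h3, fun h => hu2 x h h4⟩
    have hpb : b' = p := by
      by_contra hc
      have hpN : p ∈ N v := hu2 p hp (fun e => hc e.symm)
      have h3 := hmove p (hT hp) b' (hT hbT') (by simp [hrk, hp, hbT', hc]) v hv hpN hbN'
      rw [hT'] at h3
      have h4 := hp
      rw [h3, left_mem_tw] at h4
      exact hbN' h4
    subst hpb
    refine ⟨b, hNB v hv hbN, hbT, ?_, hT', ?_⟩
    · ext x
      simp only [Finset.mem_insert, Finset.mem_erase]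
      constructor
      · intro hx
        by_cases hxb : x = b
        · exact .inl hxb
        · exact .inr ⟨fun e => hbN' (e ▸ hx), hu1 x hx hxb⟩
      · rintro (rfl | ⟨h3, h4⟩)
        · exact hbN
        · exact hu2 x h4 h3
    · intro hc
      rw [hc] at hT'
      exact hvT hT'

/-- addition modulo `2 m + 1` -/
def ad (m a b : ℕ) : ℕ := if a + b < 2 * m + 1 then a + b else a + b - (2 * m + 1)

/-- colour classes -/
def colr {m : ℕ} : Option (Fin m) → ℕ → Prop
  | none, c => c = 2 * m
  | some i, c => c = 2 * i.val ∨ c = 2 * i.val + 1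

/-- `v` is the partner of `u` in colour `c` -/
def Qr {V : Type*} (m : ℕ) (K : Finset V) (g : V → ℕ) (r : V → V) (u v : V) (c : ℕ) : Prop :=
  (v ∈ K ∧ v ≠ u ∧ ad m (g u) (g v) = c) ∨ (v = r u ∧ ad m (g u) (g u) = c)

theorem ad_comm (m a b : ℕ) : ad m a b = ad m b a := by
  unfold ad; rw [Nat.add_comm]

theorem ad_lt {m a b : ℕ} (ha : a < 2 * m + 1) (hb : b < 2 * m + 1) : ad m a b < 2 * m + 1 := by
  unfold ad; split_ifs <;> omega

theorem ad_cancel {m a b c : ℕ} (ha : a < 2 * m + 1) (hb : b < 2 * m + 1) (hc : c < 2 * m + 1)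
    (h : ad m a b = ad m a c) : b = c := by
  unfold ad at h; split_ifs at h <;> omega

theorem ad_self {m a b : ℕ} (ha : a < 2 * m + 1) (hb : b < 2 * m + 1)
    (h : ad m a a = ad m b b) : a = b := by
  unfold ad at h; split_ifs at h <;> omega

/-- base graphs -/
def baseF {V : Type*} (m : ℕ) (J K : Finset V) (hJK : J ⊆ K) (g : V → ℕ) (r : V → V)
    (hr : ∀ v ∈ J, r v ∉ K) (i : Option (Fin m)) : SimpleGraph V where
  Adj u v := ∃ c, colr i c ∧ ((u ∈ J ∧ Qr m K g r u v c) ∨ (v ∈ J ∧ Qr m K g r v u c))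
  symm := ⟨fun _ _ ⟨c, hc, h⟩ => ⟨c, hc, h.symm⟩⟩
  loopless := ⟨by
    rintro u ⟨c, hc, ⟨hu, h | h⟩ | ⟨hu, h | h⟩⟩
    · exact h.2.1 rfl
    · exact hr u hu (h.1 ▸ hJK hu)
    · exact h.2.1 rfl
    · exact hr u hu (h.1 ▸ hJK hu)⟩

open Classical in
theorem base_sol {V : Type*} [Fintype V] [DecidableEq V] {m : ℕ} {J K : Finset V} (hJK : J ⊆ K)
    (g : V → ℕ) (hg : ∀ x ∈ K, g x < 2 * m + 1) (hinj : ∀ x ∈ K, ∀ y ∈ K, g x = g y → x = y)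
    (hsurj : ∀ c < 2 * m + 1, ∃ x ∈ K, g x = c) (r : V → V) (hr : ∀ v ∈ J, r v ∉ K)
    (hrr : ∀ u ∈ J, ∀ w ∈ J, u ≠ w → ad m (g u) (g u) / 2 = ad m (g w) (g w) / 2 → r u ≠ r w)
    (N : V → Finset V) (hN1 : ∀ v ∈ J, ∀ x ∈ K, x ∉ J → x ∈ N v) (hN2 : ∀ v ∈ J, r v ∈ N v) :
    Sol J N (baseF m J K hJK g r hr) := by
  have hadj : ∀ i, ∀ u ∈ J, ∀ v, (baseF m J K hJK g r hr i).Adj u v ↔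
      ∃ c, colr i c ∧ Qr m K g r u v c := by
    intro i u hu v
    constructor
    · rintro ⟨c, hc, ⟨-, h⟩ | ⟨hv, h | h⟩⟩
      · exact ⟨c, hc, h⟩
      · exact ⟨c, hc, .inl ⟨hJK hv, h.2.1.symm, by rw [ad_comm]; exact h.2.2⟩⟩
      · exact absurd (hJK hu) (h.1 ▸ hr v hv)
    · rintro ⟨c, hc, h⟩
      exact ⟨c, hc, .inl ⟨hu, h⟩⟩
  have hQc : ∀ u ∈ J, ∀ v c c', Qr m K g r u v c → Qr m K g r u v c' → c = c' := by
    rintro u hu v c c' (h | h) (h' | h')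
    · exact h.2.2.symm.trans h'.2.2
    · exact absurd h.1 (h'.1 ▸ hr u hu)
    · exact absurd h'.1 (h.1 ▸ hr u hu)
    · exact h.2.symm.trans h'.2
  have hQv : ∀ u ∈ J, ∀ v v' c, Qr m K g r u v c → Qr m K g r u v' c → v = v' := by
    rintro u hu v v' c (h | h) (h' | h')
    · exact hinj _ h.1 _ h'.1 (ad_cancel (hg u (hJK hu)) (hg _ h.1) (hg _ h'.1)
        (h.2.2.trans h'.2.2.symm))
    · exact absurd (hinj _ h.1 _ (hJK hu) (ad_cancel (hg u (hJK hu)) (hg _ h.1) (hg _ (hJK hu))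
        (h.2.2.trans h'.2.symm))) h.2.1
    · exact absurd (hinj _ h'.1 _ (hJK hu) (ad_cancel (hg u (hJK hu)) (hg _ h'.1) (hg _ (hJK hu))
        (h'.2.2.trans h.2.symm))) h'.2.1
    · exact h.1.trans h'.1.symm
  have hQe : ∀ u ∈ J, ∀ c < 2 * m + 1, ∃ v, Qr m K g r u v c := by
    intro u hu c hc
    have hgu := hg u (hJK hu)
    obtain ⟨x, hx, hgx⟩ := hsurj (if g u ≤ c then c - g u else c + (2 * m + 1) - g u)
      (by split_ifs <;> omega)
    have hs : ad m (g u) (g x) = c := by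
      rw [hgx]; unfold ad; split_ifs <;> omega
    by_cases hxu : x = u
    · exact ⟨r u, .inr ⟨rfl, by rw [← hs, hxu]⟩⟩
    · exact ⟨x, .inl ⟨hx, hxu, hs⟩⟩
  have hQu : ∀ u ∈ J, ∀ u' ∈ J, ∀ v c, Qr m K g r u v c → Qr m K g r u' v c → u = u' := by
    rintro u hu u' hu' v c (h | h) (h' | h')
    · refine hinj _ (hJK hu) _ (hJK hu') (ad_cancel (hg v h.1) (hg _ (hJK hu)) (hg _ (hJK hu')) ?_)
      rw [ad_comm m (g v), ad_comm m (g v)]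
      exact h.2.2.trans h'.2.2.symm
    · exact absurd h.1 (h'.1 ▸ hr u' hu')
    · exact absurd h'.1 (h.1 ▸ hr u hu)
    · exact hinj _ (hJK hu) _ (hJK hu') (ad_self (hg _ (hJK hu)) (hg _ (hJK hu'))
        (h.2.trans h'.2.symm))
  have hcol : ∀ i i' : Option (Fin m), ∀ c, colr i c → colr i' c → i = i' := by
    rintro (_ | i) (_ | i') c h h'
    · rfl
    · exfalso; have := i'.2; simp only [colr] at h h'; omega
    · exfalso; have := i.2; simp only [colr] at h h'; omega
    · congr 1; ext; simp only [colr] at h h'; omega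
  refine ⟨?_, ?_, ?_, ?_, ?_, ?_, ?_, ?_⟩
  · intro i
    have him := i.2
    let y : V → ℕ := fun x => if i.val ≤ g x then g x - i.val else g x + (2 * m + 1) - i.val
    let q : V → ℤ := fun x => if y x = 0 then 0 else if y x ≤ m then 2 * (y x : ℤ) - 1 else
      2 * (2 * m + 1 - (y x : ℤ))
    let p : V → ℤ := fun x => if x ∈ K then q x
      else if ∃ u ∈ J, x = r u ∧ ad m (g u) (g u) = 2 * i.val then -1
      else if ∃ u ∈ J, x = r u ∧ ad m (g u) (g u) = 2 * i.val + 1 then 2 * m + 1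
      else 2 * m + 2 + (Fintype.equivFin V x).val
    have hqb : ∀ x ∈ K, 0 ≤ q x ∧ q x < 2 * m + 1 := by
      intro x hx
      have := hg x hx
      simp only [q, y]
      split_ifs <;> omega
    have hqi : ∀ x ∈ K, ∀ z ∈ K, q x = q z → x = z := by
      intro x hx z hz h
      have h1 := hg x hx
      have h2 := hg z hz
      apply hinj x hx z hz
      simp only [q, y] at h
      split_ifs at h <;> omega
    have hp1 : ∀ x ∈ K, p x = q x := fun x hx => by simp only [p]; rw [if_pos hx]
    have hp2 : ∀ u ∈ J, ad m (g u) (g u) = 2 * i.val → p (r u) = -1 := fun u hu h => by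
      simp only [p]
      rw [if_neg (hr u hu), if_pos ⟨u, hu, rfl, h⟩]
    have hp3 : ∀ u ∈ J, ad m (g u) (g u) = 2 * i.val + 1 → p (r u) = 2 * m + 1 := fun u hu h => by
      simp only [p]
      rw [if_neg (hr u hu), if_neg, if_pos ⟨u, hu, rfl, h⟩]
      rintro ⟨w, hw, h1, h2⟩
      refine hrr u hu w hw ?_ (by omega) h1
      rintro rfl
      omega
    refine ⟨p, ?_, ?_⟩
    · intro x z h
      by_cases hx : x ∈ K
      · have hx' := hqb x hx
        by_cases hz : z ∈ K
        · rw [hp1 x hx, hp1 z hz] at h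
          exact hqi x hx z hz h
        · exfalso
          rw [hp1 x hx] at h
          simp only [p] at h
          rw [if_neg hz] at h
          split_ifs at h <;> omega
      · by_cases hz : z ∈ K
        · exfalso
          have hz' := hqb z hz
          rw [hp1 z hz] at h
          simp only [p] at h
          rw [if_neg hx] at h
          split_ifs at h <;> omega
        · simp only [p] at h
          rw [if_neg hx, if_neg hz] at h
          split_ifs at h with h1 h2 h3 h4 h5 h6 h7 h8
          · obtain ⟨u, hu, rfl, h1⟩ := h1
            obtain ⟨w, hw, rfl, h2⟩ := h2
            rw [hQu u hu w hw (r u) (2 * i.val) (.inr ⟨rfl, h1⟩) (.inr ⟨?_, h2⟩)]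
            have := hinj _ (hJK hu) _ (hJK hw) (ad_self (hg _ (hJK hu)) (hg _ (hJK hw))
              (h1.trans h2.symm))
            rw [this]
          all_goals first
            | (exfalso; omega)
            | skip
          · obtain ⟨u, hu, rfl, hh1⟩ := ‹∃ u ∈ J, x = r u ∧ _›
            obtain ⟨w, hw, rfl, hh2⟩ := ‹∃ u ∈ J, z = r u ∧ _›
            have := hinj _ (hJK hu) _ (hJK hw) (ad_self (hg _ (hJK hu)) (hg _ (hJK hw))
              (hh1.trans hh2.symm))
            rw [this]
          · have h9 : (Fintype.equivFin V x).val = (Fintype.equivFin V z).val := by omega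
            exact (Fintype.equivFin V).injective (Fin.ext h9)
    · have key : ∀ u ∈ J, ∀ v c, colr (some i) c → Qr m K g r u v c →
          p v = p u + 1 ∨ p u = p v + 1 := by
        rintro u hu v c hc (⟨hv, hvu, h⟩ | ⟨rfl, h⟩)
        · have h1 := hg u (hJK hu)
          have h2 := hg v hv
          have h3 : g v ≠ g u := fun e => hvu (hinj _ hv _ (hJK hu) e)
          rw [hp1 u (hJK hu), hp1 v hv]
          simp only [colr] at hc
          unfold ad at h
          simp only [q, y]
          split_ifs at h ⊢ <;> omega
        · have h1 := hg u (hJK hu)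
          rcases hc with hc | hc
          · rw [hp2 u hu (h.trans hc), hp1 u (hJK hu)]
            unfold ad at h
            simp only [q, y]
            split_ifs at h ⊢ <;> omega
          · rw [hp3 u hu (h.trans hc), hp1 u (hJK hu)]
            unfold ad at h
            simp only [q, y]
            split_ifs at h ⊢ <;> omega
      rintro u v ⟨c, hc, ⟨hu, h⟩ | ⟨hv, h⟩⟩
      · exact key u hu v c hc h
      · exact (key v hv u c hc h).symm
  · intro v x z hx hz
    by_cases hv : v ∈ J
    · obtain ⟨c, hc, h⟩ := (hadj none v hv x).1 hx
      obtain ⟨c', hc', h'⟩ := (hadj none v hv z).1 hz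
      have : c = c' := hc.trans hc'.symm
      subst this
      exact hQv v hv _ _ _ h h'
    · obtain ⟨c, hc, h⟩ := hx
      obtain ⟨c', hc', h'⟩ := hz
      have : c = c' := hc.trans hc'.symm
      subst this
      have h := h.resolve_left (fun h => hv h.1)
      have h' := h'.resolve_left (fun h => hv h.1)
      exact hQu x h.1 z h'.1 v c h.2 h'.2
  · have key : ∀ i i', ∀ u ∈ J, ∀ v, (baseF m J K hJK g r hr i).Adj u v →
        (baseF m J K hJK g r hr i').Adj u v → i = i' := by
      intro i i' u hu v h h'
      obtain ⟨c, hc, h⟩ := (hadj i u hu v).1 h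
      obtain ⟨c', hc', h'⟩ := (hadj i' u hu v).1 h'
      have := hQc u hu v _ _ h h'
      subst this
      exact hcol i i' c hc hc'
    intro i i' u v h h'
    have h0 := h
    obtain ⟨c, hc, h1 | h1⟩ := h0
    · exact key i i' u h1.1 v h h'
    · exact key i i' v h1.1 u h.symm h'.symm
  · intro u hu v hv huv
    have hc : ad m (g u) (g v) < 2 * m + 1 := ad_lt (hg u (hJK hu)) (hg v (hJK hv))
    by_cases h : ad m (g u) (g v) = 2 * m
    · exact ⟨none, _, h, .inl ⟨hu, .inl ⟨hJK hv, huv.symm, rfl⟩⟩⟩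
    · refine ⟨some ⟨ad m (g u) (g v) / 2, by omega⟩, _, ?_,
        .inl ⟨hu, .inl ⟨hJK hv, huv.symm, rfl⟩⟩⟩
      simp only [colr]
      omega
  · rintro i u v ⟨c, hc, h | h⟩
    · exact .inl h.1
    · exact .inr h.1
  · intro i u v h hu hv
    obtain ⟨c, hc, h | h⟩ := (hadj i u hu v).1 h
    · exact hN1 u hu v h.1 hv
    · rw [h.1]; exact hN2 u hu
  · intro i v hv
    have him := i.2
    obtain ⟨a, ha⟩ := hQe v hv (2 * i.val) (by omega)
    obtain ⟨b, hb⟩ := hQe v hv (2 * i.val + 1) (by omega)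
    have hab : a ≠ b := by
      rintro rfl
      have := hQc v hv _ _ _ ha hb
      omega
    rw [← Set.ncard_pair hab]
    congr 1
    ext x
    rw [SimpleGraph.mem_neighborSet, hadj (some i) v hv x]
    simp only [colr, Set.mem_insert_iff, Set.mem_singleton_iff]
    constructor
    · rintro ⟨c, rfl | rfl, h⟩
      · exact .inl (hQv v hv _ _ _ h ha)
      · exact .inr (hQv v hv _ _ _ h hb)
    · rintro (rfl | rfl)
      · exact ⟨_, .inl rfl, ha⟩
      · exact ⟨_, .inr rfl, hb⟩
  · intro v hv
    obtain ⟨a, ha⟩ := hQe v hv (2 * m) (by omega)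
    rw [← Set.ncard_singleton a]
    congr 1
    ext x
    rw [SimpleGraph.mem_neighborSet, hadj none v hv x]
    simp only [colr, Set.mem_singleton_iff]
    constructor
    · rintro ⟨c, rfl, h⟩
      exact hQv v hv _ _ _ h ha
    · rintro rfl
      exact ⟨_, rfl, ha⟩

theorem trim {V : Type*} [DecidableEq V] {X Y : Finset V} {l : ℕ} (hl : 1 ≤ l) (hX : l ≤ X.card)
    (hY : l ≤ Y.card) (h : l + 1 ≤ (X ∪ Y).card) :
    ∃ X' Y', X' ⊆ X ∧ Y' ⊆ Y ∧ X'.card = l ∧ Y'.card = l ∧ X' ≠ Y' := by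
  have key : ∀ X Y : Finset V, l ≤ X.card → l ≤ Y.card → ∀ y ∈ Y, y ∉ X →
      ∃ X' Y', X' ⊆ X ∧ Y' ⊆ Y ∧ X'.card = l ∧ Y'.card = l ∧ X' ≠ Y' := by
    intro X Y hX hY y hy hyX
    obtain ⟨X', h1, h2⟩ := Finset.exists_subset_card_eq hX
    obtain ⟨Y', h3, h4, h5⟩ := Finset.exists_subsuperset_card_eq
      (Finset.singleton_subset_iff.2 hy) (by simpa using hl) hY
    refine ⟨X', Y', h1, h4, h2, h5, ?_⟩
    rintro rfl
    exact hyX (h1 (h3 (Finset.mem_singleton_self y)))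
  by_cases h1 : ∃ y ∈ Y, y ∉ X
  · obtain ⟨y, hy, hyX⟩ := h1
    exact key X Y hX hY y hy hyX
  push Not at h1
  have hXY : X ∪ Y = X := Finset.union_eq_left.2 h1
  rw [hXY] at h
  by_cases h2 : ∃ x ∈ X, x ∉ Y
  · obtain ⟨x, hx, hxY⟩ := h2
    obtain ⟨Y', X', a1, a2, a3, a4, a5⟩ := key Y X hY hX x hx hxY
    exact ⟨X', Y', a2, a1, a4, a3, a5.symm⟩
  push Not at h2
  have hYX : Y = X := Finset.Subset.antisymm h1 h2
  subst hYX
  obtain ⟨Z, hZ, hZc⟩ := Finset.exists_subset_card_eq hY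
  obtain ⟨x, hx, hxZ⟩ := Finset.exists_mem_notMem_of_card_lt_card (s := Z) (t := Y) (by omega)
  obtain ⟨X', Y', a1, a2, a3, a4, a5⟩ := key Z Y hZc.ge hY x hx hxZ
  exact ⟨X', Y', a1.trans hZ, a2, a3, a4, a5⟩

theorem pairs_trim {V : Type*} [DecidableEq V] {J : Finset V} {l : ℕ} (hl : 1 ≤ l)
    (N0 : V → Finset V) (h1 : ∀ v ∈ J, l ≤ (N0 v).card)
    (h2 : ∀ v ∈ J, ∀ w ∈ J, v ≠ w → l + 1 ≤ (N0 v ∪ N0 w).card)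
    (σ : V → V) (hσ : ∀ v, σ (σ v) = v) (hσJ : ∀ v ∈ J, σ v ∈ J) (e : V → ℕ)
    (he : ∀ v ∈ J, σ v ≠ v → e (σ v) ≠ e v) :
    ∃ N : V → Finset V, (∀ v ∈ J, N v ⊆ N0 v) ∧ (∀ v ∈ J, (N v).card = l) ∧
      ∀ v ∈ J, σ v ≠ v → N (σ v) ≠ N v := by
  have hS : ∀ v, ∃ S : Finset V, v ∈ J → S ⊆ N0 v ∧ S.card = l := by
    intro v
    by_cases hv : v ∈ J
    · obtain ⟨S, hS⟩ := Finset.exists_subset_card_eq (h1 v hv)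
      exact ⟨S, fun _ => hS⟩
    · exact ⟨∅, fun h => absurd h hv⟩
  have hP : ∀ v w, ∃ P : Finset V × Finset V, v ∈ J → w ∈ J → v ≠ w →
      P.1 ⊆ N0 v ∧ P.2 ⊆ N0 w ∧ P.1.card = l ∧ P.2.card = l ∧ P.1 ≠ P.2 := by
    intro v w
    by_cases hv : v ∈ J ∧ w ∈ J ∧ v ≠ w
    · obtain ⟨X', Y', h⟩ := trim hl (h1 v hv.1) (h1 w hv.2.1) (h2 v hv.1 w hv.2.1 hv.2.2)
      exact ⟨(X', Y'), fun _ _ _ => h⟩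
    · exact ⟨(∅, ∅), fun a b c => absurd ⟨a, b, c⟩ hv⟩
  choose S hS using hS
  choose P hP using hP
  refine ⟨fun v => if σ v = v then S v else if e v < e (σ v) then (P v (σ v)).1 else
    (P (σ v) v).2, ?_, ?_, ?_⟩
  · intro v hv
    dsimp only
    split_ifs with a1 a2
    · exact (hS v hv).1
    · exact (hP v (σ v) hv (hσJ v hv) (Ne.symm a1)).1
    · exact (hP (σ v) v (hσJ v hv) hv a1).2.1
  · intro v hv
    dsimp only
    split_ifs with a1 a2
    · exact (hS v hv).2
    · exact (hP v (σ v) hv (hσJ v hv) (Ne.symm a1)).2.2.1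
    · exact (hP (σ v) v (hσJ v hv) hv a1).2.2.2.1
  · intro v hv hvs
    have h3 := he v hv hvs
    simp only [hσ, hvs, hvs.symm, if_false]
    rcases Nat.lt_or_gt_of_ne h3 with h4 | h4
    · rw [if_pos h4, if_neg (by omega)]
      exact (hP (σ v) v (hσJ v hv) hv hvs).2.2.2.2
    · rw [if_neg (by omega), if_pos h4]
      exact (hP v (σ v) hv (hσJ v hv) hvs.symm).2.2.2.2.symm

open Classical in
theorem exists_sigma {V : Type*} (J : Finset V) (e : V → ℕ)
    (he : ∀ u ∈ J, ∀ v ∈ J, e u = e v → u = v) :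
    ∃ σ : V → V, (∀ v, σ (σ v) = v) ∧ (∀ v ∈ J, σ v ∈ J) ∧ (∀ v, v ∉ J → σ v = v) ∧
      (∀ u ∈ J, ∀ w ∈ J, u ≠ w → e u / 2 = e w / 2 → σ u = w) := by
  have huniq : ∀ u ∈ J, ∀ w ∈ J, ∀ w' ∈ J, w ≠ u → w' ≠ u → e w / 2 = e u / 2 →
      e w' / 2 = e u / 2 → w = w' := by
    intro u hu w hw w' hw' h1 h2 h3 h4
    apply he w hw w' hw'
    have h5 : e w ≠ e u := fun h => h1 (he w hw u hu h)
    have h6 : e w' ≠ e u := fun h => h2 (he w' hw' u hu h)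
    omega
  let R : V → Prop := fun v => v ∈ J ∧ ∃ w ∈ J, w ≠ v ∧ e w / 2 = e v / 2
  let σ : V → V := fun v => if h : R v then h.2.choose else v
  have h1 : ∀ v, R v → σ v ∈ J ∧ σ v ≠ v ∧ e (σ v) / 2 = e v / 2 := by
    intro v h
    have : σ v = h.2.choose := by simp only [σ]; rw [dif_pos h]
    rw [this]
    exact h.2.choose_spec
  have h2 : ∀ v, ¬ R v → σ v = v := by
    intro v h
    simp only [σ]; rw [dif_neg h]
  have h3 : ∀ u ∈ J, ∀ w ∈ J, u ≠ w → e u / 2 = e w / 2 → σ u = w := by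
    intro u hu w hw huw h
    have hR : R u := ⟨hu, w, hw, huw.symm, h.symm⟩
    obtain ⟨a1, a2, a3⟩ := h1 u hR
    exact huniq u hu _ a1 w hw a2 huw.symm a3 h.symm
  refine ⟨σ, ?_, ?_, ?_, h3⟩
  · intro v
    by_cases hR : R v
    · obtain ⟨a1, a2, a3⟩ := h1 v hR
      exact h3 _ a1 v hR.1 a2 a3
    · rw [h2 v hR, h2 v hR]
  · intro v hv
    by_cases hR : R v
    · exact (h1 v hR).1
    · rw [h2 v hR]; exact hv
  · intro v hv
    exact h2 v (fun h => hv h.1)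

theorem main_sol {V : Type*} [Fintype V] [DecidableEq V] {m l : ℕ} {J B : Finset V}
    (hJB : Disjoint J B) (hJ : J.Nonempty) (hl : 1 ≤ l) (hc : J.card + l = 2 * m + 2)
    (N0 : V → Finset V) (hN0 : ∀ v, N0 v ⊆ B) (h1 : ∀ v ∈ J, l ≤ (N0 v).card)
    (h2 : ∀ v ∈ J, ∀ w ∈ J, v ≠ w → l + 1 ≤ (N0 v ∪ N0 w).card) :
    ∃ F : Option (Fin m) → SimpleGraph V, Sol J N0 F := by
  obtain ⟨v0, hv0⟩ := hJ
  obtain ⟨T, hTN, hTc⟩ := Finset.exists_subset_card_eq (h1 v0 hv0)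
  have hTB : T ⊆ B := hTN.trans (hN0 v0)
  obtain ⟨p, hp⟩ : T.Nonempty := Finset.card_pos.1 (by omega)
  obtain ⟨K, hK⟩ : ∃ K, K = J ∪ T.erase p := ⟨_, rfl⟩
  have hJK : J ⊆ K := hK ▸ Finset.subset_union_left
  have hnJ : ∀ x ∈ B, x ∉ J := fun x hx hc => Finset.disjoint_left.1 hJB hc hx
  have hKc : K.card = 2 * m + 1 := by
    rw [hK, Finset.card_union_of_disjoint, Finset.card_erase_of_mem hp]
    · omega
    · exact Finset.disjoint_of_subset_right ((Finset.erase_subset _ _).trans hTB) hJB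
  obtain ⟨g, hg, hinj, hsurj⟩ : ∃ g : V → ℕ, (∀ x ∈ K, g x < 2 * m + 1) ∧
      (∀ x ∈ K, ∀ y ∈ K, g x = g y → x = y) ∧ (∀ c < 2 * m + 1, ∃ x ∈ K, g x = c) := by
    let E := K.equivFinOfCardEq hKc
    refine ⟨fun x => if h : x ∈ K then (E ⟨x, h⟩).val else 0, ?_, ?_, ?_⟩
    · intro x hx
      simp only [hx, dif_pos]
      exact (E _).2
    · intro x hx y hy h
      simp only [hx, hy, dif_pos] at h
      have := E.injective (Fin.ext h)
      exact congrArg Subtype.val this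
    · intro c hc
      refine ⟨(E.symm ⟨c, hc⟩).1, (E.symm ⟨c, hc⟩).2, ?_⟩
      simp
  obtain ⟨σ, hσ, hσJ, hσo, hσm⟩ := exists_sigma J (fun u => ad m (g u) (g u))
    (fun u hu v hv h => hinj _ (hJK hu) _ (hJK hv) (ad_self (hg _ (hJK hu)) (hg _ (hJK hv)) h))
  obtain ⟨N, hN1, hN2, hN3⟩ := pairs_trim hl N0 h1 h2 σ hσ hσJ (fun u => ad m (g u) (g u))
    (fun v hv hvs h => hvs (hinj _ (hJK (hσJ v hv)) _ (hJK hv)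
      (ad_self (hg _ (hJK (hσJ v hv))) (hg _ (hJK hv)) h)))
  obtain ⟨F, hF⟩ : ∃ F : Option (Fin m) → SimpleGraph V, Sol J N F := by
    refine compress σ hσ hσJ hσo hJB hTB hp ?_ N (fun v hv => (hN1 v hv).trans (hN0 v))
      (fun v hv => by rw [hN2 v hv, hTc]) hN3
    clear hN1 hN2 hN3 N
    intro N hN hNp
    have hr : ∀ v, ∃ x, v ∈ J → (N v = T ∧ x = p) ∨ (x ∈ B ∧ x ∉ T ∧
        N v = insert x (T.erase p) ∧ N (σ v) = T ∧ σ v ≠ v) := by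
      intro v
      by_cases hv : v ∈ J
      · rcases hN v hv with h | ⟨b, h⟩
        · exact ⟨p, fun _ => .inl ⟨h, rfl⟩⟩
        · exact ⟨b, fun _ => .inr h⟩
      · exact ⟨v, fun h => absurd h hv⟩
    choose r hr using hr
    refine ⟨_, base_sol hJK g hg hinj hsurj r ?_ ?_ N ?_ ?_⟩
    · intro v hv
      rw [hK, Finset.mem_union, Finset.mem_erase]
      rcases hr v hv with ⟨-, h⟩ | ⟨hB, hT, -⟩
      · rw [h]
        have := hnJ p (hTB hp)
        tauto
      · have := hnJ _ hB
        tauto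
    · intro u hu w hw huw h hrw
      have hs := hσm u hu w hw huw h
      have hs' : σ w = u := by rw [← hs, hσ]
      rcases hr u hu with ⟨a1, a2⟩ | ⟨a1, a2, a3, a4, a5⟩
      · rcases hr w hw with ⟨b1, b2⟩ | ⟨b1, b2, b3, b4, b5⟩
        · exact hNp u hu (by rw [hs]; exact huw.symm) (by rw [hs, a1, b1])
        · exact b2 (by rw [← hrw, a2]; exact hp)
      · rcases hr w hw with ⟨b1, b2⟩ | ⟨b1, b2, b3, b4, b5⟩
        · exact a2 (by rw [hrw, b2]; exact hp)
        · rw [hs] at a4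
          apply b2
          rw [← a4, b3]
          exact Finset.mem_insert_self _ _
    · intro v hv x hx hxJ
      rw [hK, Finset.mem_union] at hx
      have hx := hx.resolve_left hxJ
      rcases hr v hv with ⟨h, -⟩ | ⟨-, -, h, -⟩
      · rw [h]; exact Finset.mem_of_mem_erase hx
      · rw [h]; exact Finset.mem_insert_of_mem hx
    · intro v hv
      rcases hr v hv with ⟨h, h'⟩ | ⟨-, -, h, -⟩
      · rw [h, h']; exact hp
      · rw [h]; exact Finset.mem_insert_self _ _
  exact ⟨F, { hF with lst := fun i u v h hu hv => hN1 u hu (hF.lst i u v h hu hv) }⟩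

end PackLF

/-- Lemma on packing linear forests (odd case). With the same setup and hypotheses as in
the even case but `k` odd, `G` contains `(k-1)/2` pairwise edge-disjoint linear forests and
one matching, all pairwise edge-disjoint, containing all edges of the clique on `J`, such
that every vertex of `J` has degree `2` in each forest and degree `1` in the matching. -/
theorem stmt7 {V : Type*} [Fintype V] [DecidableEq V] (k j : ℕ) (hk : 1 ≤ k) (hko : Odd k)
    (hj1 : 1 ≤ j) (hjk : j ≤ k)
    (J B : Finset V) (hdisj : Disjoint J B) (hcover : J ∪ B = Finset.univ)
    (hJcard : J.card = j)
    (G : SimpleGraph V)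
    (hclique : ∀ u ∈ J, ∀ v ∈ J, u ≠ v → G.Adj u v)
    (hnoB : ∀ u ∈ B, ∀ v ∈ B, ¬ G.Adj u v)
    (hdeg : ∀ v ∈ J, k - j + 1 ≤ (G.neighborSet v ∩ ↑B).ncard)
    (hapex : ∃ v ∈ J, k - j + 2 ≤ (G.neighborSet v ∩ ↑B).ncard)
    (hpair : ∀ v ∈ J, ∀ v' ∈ J, v ≠ v' →
      k - j + 2 ≤ (((G.neighborSet v ∪ G.neighborSet v') ∩ ↑B) \ {v, v'}).ncard) :
    ∃ (F : Fin ((k - 1) / 2) → SimpleGraph V) (M : SimpleGraph V),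
      (∀ i, F i ≤ G) ∧ M ≤ G ∧
      -- each F i is a linear forest
      (∀ i, (F i).IsAcyclic ∧ ∀ v, ((F i).neighborSet v).ncard ≤ 2) ∧
      -- M is a matching
      (∀ v, (M.neighborSet v).ncard ≤ 1) ∧
      -- all pairwise edge-disjoint
      (∀ i i', i ≠ i' → Disjoint (F i).edgeSet (F i').edgeSet) ∧
      (∀ i, Disjoint (F i).edgeSet M.edgeSet) ∧
      -- together they contain all edges of the clique on J
      (∀ u ∈ J, ∀ v ∈ J, u ≠ v → (∃ i, (F i).Adj u v) ∨ M.Adj u v) ∧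
      -- degrees on J
      (∀ i, ∀ v ∈ J, ((F i).neighborSet v).ncard = 2) ∧
      (∀ v ∈ J, (M.neighborSet v).ncard = 1) := by
  classical
  obtain ⟨m, rfl⟩ := hko
  have hm : (2 * m + 1 - 1) / 2 = m := by omega
  rw [hm]
  have hset : ∀ v, (G.neighborSet v ∩ (B : Set V)) = ((B.filter (G.Adj v) : Finset V) : Set V) := by
    intro v
    ext x
    simp [and_comm]
  have hnJ : ∀ v, v ∉ J → v ∈ B := fun v hv => by
    have := Finset.mem_univ v
    rw [← hcover, Finset.mem_union] at this
    exact this.resolve_left hv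
  obtain ⟨F, hF⟩ := PackLF.main_sol (m := m) (l := 2 * m + 1 - j + 1) hdisj
    (Finset.card_pos.1 (by omega)) (by omega) (by omega) (fun v => B.filter (G.Adj v))
    (fun v => Finset.filter_subset _ _)
    (fun v hv => by
      have := hdeg v hv
      rwa [hset, Set.ncard_coe_finset] at this)
    (fun v hv w hw hvw => by
      have h1 := hpair v hv w hw hvw
      refine le_trans h1 ?_
      rw [← Set.ncard_coe_finset]
      apply Set.ncard_le_ncard _ (Set.toFinite _)
      rintro x ⟨⟨h2, h3⟩, -⟩
      simp only [Finset.coe_union, Finset.coe_filter, Set.mem_union, Set.mem_setOf_eq]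
      rcases h2 with h2 | h2
      · exact .inl ⟨h3, h2⟩
      · exact .inr ⟨h3, h2⟩)
  have hle : ∀ i, F i ≤ G := by
    intro i
    have key : ∀ u ∈ J, ∀ v, (F i).Adj u v → G.Adj u v := by
      intro u hu v huv
      by_cases hv : v ∈ J
      · exact hclique u hu v hv huv.ne
      · exact (Finset.mem_filter.1 (hF.lst i u v huv hu hv)).2
    intro u v huv
    rcases hF.inJ i u v huv with h | h
    · exact key u h v huv
    · exact (key v h u huv.symm).symm
  have hdj : ∀ i i', i ≠ i' → Disjoint (F i).edgeSet (F i').edgeSet := by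
    intro i i' hne
    rw [Set.disjoint_left]
    intro s
    induction s using Sym2.ind with
    | _ u v => exact fun h h' => hne (hF.disj i i' u v h h')
  refine ⟨fun i => F (some i), F none, fun i => hle _, hle _,
    fun i => ⟨(hF.lin i).acyclic, (hF.lin i).deg⟩, hF.mat.deg,
    fun i i' h => hdj _ _ (by simpa using h), fun i => hdj _ _ (by simp), ?_, hF.deg2, hF.deg1⟩
  intro u hu v hv huv
  obtain ⟨i, hi⟩ := hF.cov u hu v hv huv
  cases i with
  | none => exact .inr hi
  | some i => exact .inl ⟨i, hi⟩
end

section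
/- Let F be a graph with maximum degree at most 2 (a disjoint union of paths and cycles) on a vertex set V, let v ∉ V(F) or v a vertex of degree 0 in F, and let U be a set of vertices with |U| = t + δ where δ ∈ {1,2}, such that at most t vertices of U have degree 2 in F. If U contains more than δ vertices of degree at most 1 in F, or contains a vertex of degree 0 in F, then one can add δ edges from v to distinct vertices of U so that the resulting graph still has maximum degree at most 2 and contains no cycle through v. -/
open SimpleGraph in
/-- The degree is at least two as soon as there are two distinct neighbours. -/
lemma aux_eq_of_ncard_le_one {V : Type*} [Fintype V] {F : SimpleGraph V} {x y z : V}
    (h : (F.neighborSet x).ncard ≤ 1) (hy : F.Adj x y) (hz : F.Adj x z) : y = z :=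
  (Set.ncard_le_one (Set.toFinite _)).1 h y hy z hz

lemma aux_eq_of_ncard_le_two {V : Type*} [Fintype V] {F : SimpleGraph V} {x y z w : V}
    (h : (F.neighborSet x).ncard ≤ 2) (hy : F.Adj x y) (hz : F.Adj x z) (hyz : y ≠ z)
    (hw : F.Adj x w) : w = y ∨ w = z := by
  by_contra! hc
  have hsub : ({w, y, z} : Set V) ⊆ F.neighborSet x := by
    rintro u (rfl | rfl | rfl) <;> assumption
  have h1 := Set.ncard_le_ncard hsub (Set.toFinite _)
  rw [Set.ncard_eq_three.2 ⟨w, y, z, hc.1, hc.2, hyz, rfl⟩] at h1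
  omega

/-- No three distinct vertices of degree at most one in one component. -/
lemma aux_three {V : Type*} [Fintype V] {F : SimpleGraph V}
    (hdeg : ∀ w, (F.neighborSet w).ncard ≤ 2) {a b c : V}
    (ha : (F.neighborSet a).ncard ≤ 1) (hb : (F.neighborSet b).ncard ≤ 1)
    (hc : (F.neighborSet c).ncard ≤ 1) (hab : a ≠ b) (hac : a ≠ c) (hbc : b ≠ c)
    (h1 : F.Reachable a b) (h2 : F.Reachable a c) : False := by
  classical
  obtain ⟨p, hp⟩ := h1.exists_isPath
  have hlen : 0 < p.length := by
    rcases Nat.eq_zero_or_pos p.length with h | h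
    · exact absurd (SimpleGraph.Walk.eq_of_length_eq_zero h) hab
    · exact h
  have inj := hp.getVert_injOn
  have hinner : ∀ i, 0 < i → i < p.length →
      F.Adj (p.getVert i) (p.getVert (i-1)) ∧ F.Adj (p.getVert i) (p.getVert (i+1)) ∧
      p.getVert (i-1) ≠ p.getVert (i+1) := by
    intro i hi hi2
    refine ⟨?_, p.adj_getVert_succ hi2, ?_⟩
    · have := p.adj_getVert_succ (i := i-1) (by omega)
      rw [Nat.sub_add_cancel hi] at this
      exact this.symm
    · intro h
      have := inj (by simp; omega) (by simp; omega) h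
      omega
  have hclosed : ∀ x y, x ∈ p.support → F.Adj x y → y ∈ p.support := by
    intro x y hx hxy
    obtain ⟨i, rfl, hi⟩ := SimpleGraph.Walk.mem_support_iff_exists_getVert.1 hx
    rcases Nat.eq_zero_or_pos i with rfl | hi0
    · have h := p.adj_getVert_succ hlen
      rw [SimpleGraph.Walk.getVert_zero] at h hxy
      rw [aux_eq_of_ncard_le_one ha hxy h]
      exact p.getVert_mem_support _
    · rcases hi.lt_or_eq with hlt | rfl
      · obtain ⟨e1, e2, e3⟩ := hinner i hi0 hlt
        rcases aux_eq_of_ncard_le_two (hdeg _) e1 e2 e3 hxy with rfl | rfl <;>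
          exact p.getVert_mem_support _
      · have h := p.adj_getVert_succ (i := p.length - 1) (by omega)
        rw [Nat.sub_add_cancel hlen] at h
        rw [SimpleGraph.Walk.getVert_length] at h hxy
        rw [aux_eq_of_ncard_le_one hb hxy h.symm]
        exact p.getVert_mem_support _
  have hwalk : ∀ x y, F.Walk x y → x ∈ p.support → y ∈ p.support := by
    intro x y q
    induction q with
    | nil => exact id
    | cons h q ih => exact fun hx => ih (hclosed _ _ hx h)
  obtain ⟨q⟩ := h2
  have hcs := hwalk a c q p.start_mem_support
  obtain ⟨i, rfl, hi⟩ := SimpleGraph.Walk.mem_support_iff_exists_getVert.1 hcs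
  have hi0 : 0 < i := by
    rcases Nat.eq_zero_or_pos i with rfl | h
    · simp at hac
    · exact h
  have hi1 : i < p.length := by
    rcases hi.lt_or_eq with h | rfl
    · exact h
    · simp at hbc
  obtain ⟨e1, e2, e3⟩ := hinner i hi0 hi1
  exact e3 (aux_eq_of_ncard_le_one hc e1 e2)

lemma aux_adj {V : Type*} {F : SimpleGraph V} {v : V} {W : Set V} {x y : V}
    (h : (F ⊔ SimpleGraph.fromEdgeSet ((fun u => s(v, u)) '' W)).Adj x y) :
    F.Adj x y ∨ (x = v ∧ y ∈ W) ∨ (y = v ∧ x ∈ W) := by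
  rw [SimpleGraph.sup_adj, SimpleGraph.fromEdgeSet_adj] at h
  rcases h with h | ⟨⟨u, hu, h⟩, -⟩
  · exact Or.inl h
  · simp only [Sym2.eq_iff] at h
    rcases h with ⟨rfl, rfl⟩ | ⟨rfl, rfl⟩
    · exact Or.inr (Or.inl ⟨rfl, hu⟩)
    · exact Or.inr (Or.inr ⟨rfl, hu⟩)

lemma aux_reach {V : Type*} {F : SimpleGraph V} {v : V} {W : Set V} {x y : V}
    (q : (F ⊔ SimpleGraph.fromEdgeSet ((fun u => s(v, u)) '' W)).Walk x y)
    (hq : v ∉ q.support) : F.Reachable x y := by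
  induction q with
  | nil => exact SimpleGraph.Reachable.refl _
  | cons h q ih =>
    rw [SimpleGraph.Walk.support_cons, List.mem_cons, not_or] at hq
    refine SimpleGraph.Reachable.trans ?_ (ih hq.2)
    rcases aux_adj h with h | ⟨h, -⟩ | ⟨h, -⟩
    · exact h.reachable
    · exact absurd h.symm hq.1
    · exact absurd (h ▸ q.start_mem_support) hq.2

lemma aux_cycle {V : Type*} {F : SimpleGraph V} {v : V} (hv : F.neighborSet v = ∅)
    {W : Set V} (hvW : v ∉ W) (hW : ∀ x ∈ W, ∀ y ∈ W, x ≠ y → ¬ F.Reachable x y)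
    (p : (F ⊔ SimpleGraph.fromEdgeSet ((fun u => s(v, u)) '' W)).Walk v v) :
    ¬ p.IsCycle := by
  have hnb : ∀ x, (F ⊔ SimpleGraph.fromEdgeSet ((fun u => s(v, u)) '' W)).Adj v x → x ∈ W := by
    intro x h
    rcases aux_adj h with h | ⟨-, h⟩ | ⟨-, h⟩
    · have : x ∈ F.neighborSet v := h
      simp [hv] at this
    · exact h
    · exact absurd h hvW
  intro hp
  cases p with
  | nil => exact SimpleGraph.Walk.IsCycle.not_of_nil hp
  | @cons _ x _ h q =>
    rw [SimpleGraph.Walk.cons_isCycle_iff] at hp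
    obtain ⟨hq, he⟩ := hp
    have hq' := hq.reverse
    have he' : s(v, x) ∉ q.reverse.edges := by simpa using he
    generalize q.reverse = r at hq' he'
    cases r with
    | nil => exact hvW (hnb _ h)
    | @cons _ y _ h' r =>
      rw [SimpleGraph.Walk.cons_isPath_iff] at hq'
      refine hW y (hnb _ h') x (hnb _ h) ?_ (aux_reach r hq'.2)
      rintro rfl
      simp at he'

lemma aux_main {V : Type*} [Fintype V] {F : SimpleGraph V}
    (hdeg : ∀ w, (F.neighborSet w).ncard ≤ 2)
    {v : V} (hv : F.neighborSet v = ∅) {W : Set V} (hvW : v ∉ W) (hc : W.ncard ≤ 2)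
    (hlow : ∀ x ∈ W, (F.neighborSet x).ncard ≤ 1) (w : V) :
    ((F ⊔ SimpleGraph.fromEdgeSet ((fun u => s(v, u)) '' W)).neighborSet w).ncard ≤ 2 := by
  by_cases hwv : w = v
  · subst hwv
    refine (Set.ncard_le_ncard ?_ (Set.toFinite _)).trans hc
    intro x hx
    rcases aux_adj hx with h | ⟨-, h⟩ | ⟨-, h⟩
    · have : x ∈ F.neighborSet w := h
      simp [hv] at this
    · exact h
    · exact absurd h hvW
  · by_cases hwW : w ∈ W
    · refine (Set.ncard_le_ncard (t := insert v (F.neighborSet w)) ?_ (Set.toFinite _)).trans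
        ((Set.ncard_insert_le _ _).trans (by have := hlow w hwW; omega))
      intro x hx
      rcases aux_adj hx with h | ⟨h, -⟩ | ⟨h, -⟩
      · exact Or.inr h
      · exact absurd h hwv
      · exact Or.inl h
    · refine (Set.ncard_le_ncard ?_ (Set.toFinite _)).trans (hdeg w)
      intro x hx
      rcases aux_adj hx with h | ⟨h, -⟩ | ⟨-, h⟩
      · exact h
      · exact absurd h hwv
      · exact absurd h hwW


/-- Let `F` be a linear forest (acyclic, max degree ≤ 2), `v` a vertex of degree `0` in
`F`, and `U` a set of `t + δ` vertices (`δ ∈ {1,2}`, `v ∉ U`) of which at most `t` have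
degree `2` in `F`. If `U` contains more than `δ` vertices of degree at most `1` in `F`, or
contains a vertex of degree `0` in `F`, then one can add `δ` edges from `v` to distinct
vertices of `U` so that the resulting graph still has maximum degree at most `2` and has
no cycle through `v`. -/
theorem stmt13 {V : Type*} [Fintype V] (F : SimpleGraph V)
    (hac : F.IsAcyclic) (hdeg : ∀ w, (F.neighborSet w).ncard ≤ 2)
    (v : V) (hv : F.neighborSet v = ∅)
    (t δ : ℕ) (hδ : δ = 1 ∨ δ = 2)
    (U : Set V) (hvU : v ∉ U) (hUcard : U.ncard = t + δ)
    (hU2 : {u ∈ U | (F.neighborSet u).ncard = 2}.ncard ≤ t)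
    (hgood : δ < {u ∈ U | (F.neighborSet u).ncard ≤ 1}.ncard ∨
      ∃ u ∈ U, F.neighborSet u = ∅) :
    ∃ W ⊆ U, W.ncard = δ ∧
      (∀ w, (((F ⊔ SimpleGraph.fromEdgeSet ((fun u => s(v, u)) '' W)).neighborSet w).ncard
        ≤ 2) ) ∧
      (∀ p : (F ⊔ SimpleGraph.fromEdgeSet ((fun u => s(v, u)) '' W)).Walk v v,
        ¬ p.IsCycle) := by

  set S : Set V := {u ∈ U | (F.neighborSet u).ncard ≤ 1} with hS
  have hScard : δ ≤ S.ncard := by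
    have hsub : U ⊆ {u ∈ U | (F.neighborSet u).ncard = 2} ∪ S := by
      intro u hu
      by_cases h : (F.neighborSet u).ncard = 2
      · exact Or.inl ⟨hu, h⟩
      · exact Or.inr ⟨hu, by have := hdeg u; omega⟩
    have h1 := Set.ncard_le_ncard hsub (Set.toFinite _)
    have h2 := Set.ncard_union_le {u ∈ U | (F.neighborSet u).ncard = 2} S
    omega
  suffices h : ∃ W ⊆ S, W.ncard = δ ∧ ∀ x ∈ W, ∀ y ∈ W, x ≠ y → ¬ F.Reachable x y by
    obtain ⟨W, hWS, hWc, hW⟩ := h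
    have hvW : v ∉ W := fun h => hvU (hWS h).1
    exact ⟨W, fun x hx => (hWS hx).1, hWc,
      aux_main hdeg hv hvW (by omega) (fun x hx => (hWS hx).2), aux_cycle hv hvW hW⟩
  rcases hδ with rfl | rfl
  · obtain ⟨a, ha⟩ := (Set.ncard_pos (Set.toFinite _)).1 hScard
    refine ⟨{a}, by simpa using ha, by simp, ?_⟩
    rintro x rfl y rfl h
    exact absurd rfl h
  · suffices h : ∃ a ∈ S, ∃ b ∈ S, a ≠ b ∧ ¬ F.Reachable a b by
      obtain ⟨a, ha, b, hb, hab, hr⟩ := h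
      refine ⟨{a, b}, ?_, Set.ncard_pair hab, ?_⟩
      · rintro x (rfl | rfl) <;> assumption
      · rintro x (rfl | rfl) y (rfl | rfl) h
        · exact absurd rfl h
        · exact hr
        · exact fun h => hr h.symm
        · exact absurd rfl h
    rcases hgood with h | ⟨u, hu, hu0⟩
    · obtain ⟨a, b, c, ha, hb, hc, hab, hac', hbc⟩ :=
        (Set.two_lt_ncard_iff (Set.toFinite _)).1 h
      by_cases h1 : F.Reachable a b
      · by_cases h2 : F.Reachable a c
        · exact (aux_three hdeg ha.2 hb.2 hc.2 hab hac' hbc h1 h2).elim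
        · exact ⟨a, ha, c, hc, hac', h2⟩
      · exact ⟨a, ha, b, hb, hab, h1⟩
    · obtain ⟨b, hb, hbu⟩ := Set.exists_ne_of_one_lt_ncard (s := S) (by omega) u
      refine ⟨u, ⟨hu, by simp [hu0]⟩, b, hb, hbu.symm, ?_⟩
      rintro ⟨q⟩
      cases q with
      | nil => exact hbu rfl
      | @cons _ y _ h q =>
        have : y ∈ F.neighborSet u := h
        simp [hu0] at this
end
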